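/- arXiv:1901.00265 — 11 statements merged into one kernel-verified Lean document; each statement's English description precedes it below -/
import Mathlib

section
/- Let A be a P-module in ℝ^d. Then the interior Int(A) is dense in A, and the boundary ∂A of A has Lebesgue measure zero. -/
open MeasureTheory

section

open scoped Pointwise

/-- A convex set whose differences exhaust a finite-dimensional space has nonempty interior. -/
lemma Convex.interior_nonempty_of_forall_exists_sub {E : Type*} [NormedAddCommGroup E]
    [NormedSpace ℝ E] [FiniteDimensional ℝ E] {P : Set E} (hP : Convex ℝ P)
    (hspan : ∀ v : E, ∃ x ∈ P, ∃ y ∈ P, v = x - y) : (interior P).Nonempty := by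
  obtain ⟨x₀, hx₀, -⟩ := hspan 0
  rw [hP.interior_nonempty_iff_affineSpan_eq_top,
    AffineSubspace.affineSpan_eq_top_iff_vectorSpan_eq_top_of_nonempty ℝ E E ⟨x₀, hx₀⟩, eq_top_iff]
  rintro v -
  obtain ⟨x, hx, y, hy, rfl⟩ := hspan v
  exact vsub_mem_vectorSpan ℝ hx hy

/-- If `A` is stable under translation by the elements of a cone `P`, then translating a point
of `A` by a positive multiple of an interior point of `P` lands in the interior of `A`. -/
lemma add_smul_mem_interior_of_forall_add_mem {E : Type*} [NormedAddCommGroup E]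
    [NormedSpace ℝ E] {P A : Set E} (hcone : ∀ x ∈ P, ∀ t : ℝ, 0 ≤ t → t • x ∈ P)
    (hA : ∀ b ∈ A, ∀ p ∈ P, b + p ∈ A) {b e : E} (hb : b ∈ A) (he : e ∈ interior P)
    {t : ℝ} (ht : 0 < t) : b + t • e ∈ interior A := by
  have hopen : IsOpen (b +ᵥ t • interior P) := (isOpen_interior.smul₀ ht.ne').vadd b
  refine interior_maximal ?_ hopen ⟨t • e, Set.smul_mem_smul_set he, rfl⟩
  rintro _ ⟨_, ⟨p, hp, rfl⟩, rfl⟩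
  exact hA b hb _ (hcone p (interior_subset hp) t ht.le)

/-- If every positive multiple of `e` translates the closed set `A` into its interior, then the
frontier of `A` is null for every additive Haar measure. -/
lemma IsClosed.addHaar_frontier_eq_zero_of_add_smul_mem_interior {E : Type*}
    [NormedAddCommGroup E] [NormedSpace ℝ E] [FiniteDimensional ℝ E] [MeasurableSpace E]
    [BorelSpace E] (μ : Measure E) [μ.IsAddHaarMeasure] {A : Set E} (hA : IsClosed A) {e : E}
    (he : ∀ b ∈ A, ∀ t : ℝ, 0 < t → b + t • e ∈ interior A) : μ (frontier A) = 0 := by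
  let u : ℕ → ℝ := fun n ↦ 1 / ((n : ℝ) + 1)
  have hdisj : ∀ m n, m < n → Disjoint ({u m • e} + frontier A) ({u n • e} + frontier A) := by
    intro m n hmn
    rw [Set.disjoint_left]
    simp only [Set.singleton_add]
    rintro _ ⟨x, hx, rfl⟩ ⟨y, hy, hxy⟩
    have hpos : 0 < u m - u n := sub_pos.2 (Nat.one_div_lt_one_div hmn)
    have hyx : y = x + (u m - u n) • e := by
      rw [sub_smul, ← add_sub_assoc, eq_sub_iff_add_eq, add_comm y, add_comm x]
      exact hxy
    exact hy.2 (hyx ▸ he x (hA.frontier_subset hx) _ hpos)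
  refine Measure.addHaar_eq_zero_of_disjoint_translates μ (fun n ↦ u n • e) ?_ ?_
    isClosed_frontier.measurableSet
  · exact Metric.isBounded_range_of_tendsto _
      (tendsto_one_div_add_atTop_nhds_zero_nat.smul_const e)
  · intro m n hmn
    rcases hmn.lt_or_gt with h | h
    · exact hdisj m n h
    · exact (hdisj n m h).symm

end

/-- For a `P`-module `A` in `ℝ^d`, the interior of `A` is dense in `A` and the
boundary of `A` has Lebesgue measure zero. -/
theorem interior_dense_and_frontier_measure_zero
    (d : ℕ) (P A : Set (EuclideanSpace ℝ (Fin d)))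
    (hPclosed : IsClosed P) (hPconvex : Convex ℝ P)
    (hPcone : ∀ x ∈ P, ∀ t : ℝ, 0 ≤ t → t • x ∈ P)
    (hPspan : ∀ v : EuclideanSpace ℝ (Fin d), ∃ x ∈ P, ∃ y ∈ P, v = x - y)
    (hPpointed : P ∩ (-P) = {0})
    (hAclosed : IsClosed A) (hAproper : A ≠ Set.univ)
    (hAzero : (0 : EuclideanSpace ℝ (Fin d)) ∈ A)
    (hAmod : ∀ b ∈ A, ∀ p ∈ P, b + p ∈ A) :
    A ⊆ closure (interior A) ∧ volume (frontier A) = 0 := by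
  obtain ⟨e, he⟩ := hPconvex.interior_nonempty_of_forall_exists_sub hPspan
  have hint : ∀ b ∈ A, ∀ t : ℝ, 0 < t → b + t • e ∈ interior A := fun b hb t ht ↦
    add_smul_mem_interior_of_forall_add_mem hPcone hAmod hb he ht
  refine ⟨fun b hb ↦ ?_,
    hAclosed.addHaar_frontier_eq_zero_of_add_smul_mem_interior volume hint⟩
  have hlim : Filter.Tendsto (fun n : ℕ ↦ b + (1 / ((n : ℝ) + 1)) • e) Filter.atTop (nhds b) := by
    simpa using
      ((tendsto_one_div_add_atTop_nhds_zero_nat (𝕜 := ℝ)).smul_const e).const_add b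
  exact mem_closure_of_tendsto hlim
    (Filter.Eventually.of_forall fun n ↦ hint b hb _ Nat.one_div_pos_of_nat)
end

section
/- Let A be a P-module in ℝ^d. Then both the interior Int(A) and A itself are connected subsets of ℝ^d. -/
open MeasureTheory

/-- A convex set containing `0` whose differences exhaust a finite-dimensional space has
nonempty interior. -/
lemma Convex.interior_nonempty_of_forall_eq_sub {E : Type*} [NormedAddCommGroup E]
    [NormedSpace ℝ E] [FiniteDimensional ℝ E] {P : Set E} (hP : Convex ℝ P) (h0 : (0 : E) ∈ P)
    (hspan : ∀ v : E, ∃ x ∈ P, ∃ y ∈ P, v = x - y) : (interior P).Nonempty := by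
  rw [hP.interior_nonempty_iff_affineSpan_eq_top, eq_top_iff]
  intro v _
  obtain ⟨x, hx, y, hy, rfl⟩ := hspan v
  have h := AffineSubspace.vadd_mem_of_mem_direction
    (AffineSubspace.vsub_mem_direction (subset_affineSpan ℝ P hx) (subset_affineSpan ℝ P hy))
    (subset_affineSpan ℝ P h0)
  simpa using h

/-- A nonempty set stable under translation by a spanning cone is path connected. -/
lemma isPathConnected_of_add_mem_cone {E : Type*} [NormedAddCommGroup E] [NormedSpace ℝ E]
    {P S : Set E} (hcone : ∀ x ∈ P, ∀ t : ℝ, 0 ≤ t → t • x ∈ P)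
    (hspan : ∀ v : E, ∃ x ∈ P, ∃ y ∈ P, v = x - y)
    (hS : S.Nonempty) (hadd : ∀ b ∈ S, ∀ p ∈ P, b + p ∈ S) : IsPathConnected S := by
  have joined_add : ∀ b ∈ S, ∀ p ∈ P, JoinedIn S b (b + p) := by
    intro b hb p hp
    refine JoinedIn.of_segment_subset ?_
    rw [segment_eq_image']
    rintro _ ⟨t, ht, rfl⟩
    simpa using hadd b hb _ (hcone p hp t ht.1)
  refine isPathConnected_iff.2 ⟨hS, fun x hx y hy => ?_⟩
  obtain ⟨p, hp, q, hq, hpq⟩ := hspan (x - y)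
  have hxy : x + q = y + p := by
    rw [add_comm y p]
    exact sub_eq_sub_iff_add_eq_add.1 hpq
  exact (joined_add x hx q hq).trans (hxy ▸ (joined_add y hy p hp).symm)

/-- Stability under translation by elements of `P` passes to the interior. -/
lemma add_mem_interior_of_add_mem {E : Type*} [AddGroup E] [TopologicalSpace E]
    [ContinuousAdd E] {P A : Set E} (hadd : ∀ b ∈ A, ∀ p ∈ P, b + p ∈ A) :
    ∀ b ∈ interior A, ∀ p ∈ P, b + p ∈ interior A := by
  intro b hb p hp
  refine interior_maximal ?_ ((isOpenMap_add_right p) _ isOpen_interior) ⟨b, hb, rfl⟩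
  rintro _ ⟨c, hc, rfl⟩
  exact hadd c (interior_subset hc) p hp

/-- For a `P`-module `A` in `ℝ^d`, both the interior of `A` and `A` itself are
connected subsets. -/
theorem interior_connected_and_connected
    (d : ℕ) (P A : Set (EuclideanSpace ℝ (Fin d)))
    (hPclosed : IsClosed P) (hPconvex : Convex ℝ P)
    (hPcone : ∀ x ∈ P, ∀ t : ℝ, 0 ≤ t → t • x ∈ P)
    (hPspan : ∀ v : EuclideanSpace ℝ (Fin d), ∃ x ∈ P, ∃ y ∈ P, v = x - y)
    (hPpointed : P ∩ (-P) = {0})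
    (hAclosed : IsClosed A) (hAproper : A ≠ Set.univ)
    (hAzero : (0 : EuclideanSpace ℝ (Fin d)) ∈ A)
    (hAmod : ∀ b ∈ A, ∀ p ∈ P, b + p ∈ A) :
    IsConnected (interior A) ∧ IsConnected A := by
  have hP0 : (0 : EuclideanSpace ℝ (Fin d)) ∈ P := by
    have h : (0 : EuclideanSpace ℝ (Fin d)) ∈ P ∩ (-P) := hPpointed ▸ rfl
    exact h.1
  have hPA : P ⊆ A := fun p hp => by simpa using hAmod 0 hAzero p hp
  have hint : (interior A).Nonempty :=
    (hPconvex.interior_nonempty_of_forall_eq_sub hP0 hPspan).mono (interior_mono hPA)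
  exact ⟨(isPathConnected_of_add_mem_cone hPcone hPspan hint
      (add_mem_interior_of_add_mem hAmod)).isConnected,
    (isPathConnected_of_add_mem_cone hPcone hPspan ⟨0, hAzero⟩ hAmod).isConnected⟩
end

section
/- Let A be a P-module in ℝ^d and let a ∈ Ω. For every x ∈ ∂A and s ∈ (0,1), the point x + sa lies in Int(A) \ (A + a), and the map ∂A × (0,1) ∋ (x,s) ↦ x + sa ∈ Int(A) \ (A + a) is a continuous surjection. -/
open MeasureTheory

/-- Translating a point of a set stable under a cone `P` by a positive multiple of an interior
point of `P` leads into the interior of the set. -/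
lemma add_smul_mem_interior_of_stable {E : Type*} [AddCommGroup E] [Module ℝ E]
    [TopologicalSpace E] [IsTopologicalAddGroup E] [ContinuousSMul ℝ E] {P A : Set E}
    (hP : ∀ x ∈ P, ∀ t : ℝ, 0 ≤ t → t • x ∈ P) (hA : ∀ b ∈ A, ∀ p ∈ P, b + p ∈ A)
    {a b : E} (ha : a ∈ interior P) (hb : b ∈ A) {t : ℝ} (ht : 0 < t) :
    b + t • a ∈ interior A := by
  have hcont : Continuous fun y : E => t⁻¹ • (y - b) := by fun_prop
  refine mem_interior.2
    ⟨(fun y => t⁻¹ • (y - b)) ⁻¹' interior P, fun y hy => ?_, isOpen_interior.preimage hcont, ?_⟩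
  · have h := hA b hb _ (hP _ (interior_subset hy) t ht.le)
    simpa [smul_smul, ht.ne'] using h
  · simpa [smul_smul, ht.ne'] using ha

/-- For a `P`-module `A` and `a` in the interior `Ω` of `P`, the map
`∂A × (0,1) ∋ (x,s) ↦ x + s • a` takes values in `Int(A) \ (A + a)`, is continuous,
and is onto `Int(A) \ (A + a)`. -/
theorem boundary_param_strip
    (d : ℕ) (P A : Set (EuclideanSpace ℝ (Fin d)))
    (hPclosed : IsClosed P) (hPconvex : Convex ℝ P)
    (hPcone : ∀ x ∈ P, ∀ t : ℝ, 0 ≤ t → t • x ∈ P)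
    (hPspan : ∀ v : EuclideanSpace ℝ (Fin d), ∃ x ∈ P, ∃ y ∈ P, v = x - y)
    (hPpointed : P ∩ (-P) = {0})
    (hAclosed : IsClosed A) (hAproper : A ≠ Set.univ)
    (hAzero : (0 : EuclideanSpace ℝ (Fin d)) ∈ A)
    (hAmod : ∀ b ∈ A, ∀ p ∈ P, b + p ∈ A)
    (a : EuclideanSpace ℝ (Fin d)) (ha : a ∈ interior P) :
    (∀ x ∈ frontier A, ∀ s ∈ Set.Ioo (0:ℝ) 1,
        x + s • a ∈ interior A \ ((fun y => y + a) '' A)) ∧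
    (∀ z ∈ interior A \ ((fun y => y + a) '' A),
        ∃ x ∈ frontier A, ∃ s ∈ Set.Ioo (0:ℝ) 1, z = x + s • a) ∧
    ContinuousOn (fun p : EuclideanSpace ℝ (Fin d) × ℝ => p.1 + p.2 • a)
      (frontier A ×ˢ Set.Ioo (0:ℝ) 1) := by
  refine ⟨?_, ?_, by fun_prop⟩
  · rintro x hx s ⟨hs0, hs1⟩
    refine ⟨add_smul_mem_interior_of_stable hPcone hAmod ha (hAclosed.frontier_subset hx) hs0, ?_⟩
    rintro ⟨y, hy, hyx : y + a = x + s • a⟩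
    have hint := add_smul_mem_interior_of_stable hPcone hAmod ha hy (sub_pos.2 hs1)
    have hxy : y + (1 - s) • a = x := by
      rw [sub_smul, one_smul, ← add_sub_assoc, hyx, add_sub_cancel_right]
    exact hx.2 (hxy ▸ hint)
  · rintro z ⟨hz, hza⟩
    have hza' : z - a ∉ A := fun h => hza ⟨z - a, h, sub_add_cancel z a⟩
    have hseg : IsPreconnected ((fun s : ℝ => z - s • a) '' Set.Icc 0 1) :=
      isPreconnected_Icc.image _ (by fun_prop)
    obtain ⟨s, hs, hsA⟩ : ∃ s ∈ Set.Icc (0 : ℝ) 1, z - s • a ∈ frontier A := by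
      by_contra! hfr
      obtain ⟨y, -, hyA, hyc⟩ := hseg (interior A) Aᶜ isOpen_interior hAclosed.isOpen_compl
        (by
          rintro _ ⟨s, hs, rfl⟩
          by_contra! h
          rw [Set.mem_union, not_or, Set.notMem_compl_iff] at h
          exact hfr s hs ⟨subset_closure h.2, h.1⟩)
        ⟨z, ⟨0, by simp, by simp⟩, hz⟩ ⟨z - a, ⟨1, by simp, by simp⟩, hza'⟩
      exact hyc (interior_subset hyA)
    refine ⟨z - s • a, hsA, s, ⟨hs.1.lt_of_ne ?_, hs.2.lt_of_ne ?_⟩, (sub_add_cancel _ _).symm⟩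
    · rintro rfl
      exact hsA.2 (by simpa using hz)
    · rintro rfl
      exact hza' (by simpa using hAclosed.frontier_subset hsA)
end

section
/- Let A be a P-module in ℝ^d and let a ∈ Ω. Then the sets A + na, for n ≥ 1, form a decreasing sequence of closed subsets of ℝ^d (i.e. A + (n+1)a ⊆ A + na for every n), and the intersection ⋂_{n=1}^{∞} (A + na) is empty. -/
open MeasureTheory

/-- An interior point of a cone absorbs every vector: some positive integer multiple of it,
translated by the given vector, lies in the cone. -/
theorem exists_nat_add_smul_mem_of_mem_interior {E : Type*} [AddCommGroup E] [Module ℝ E]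
    [TopologicalSpace E] [ContinuousAdd E] [ContinuousSMul ℝ E] {P : Set E}
    (hP : ∀ x ∈ P, ∀ t : ℝ, 0 ≤ t → t • x ∈ P) {a : E} (ha : a ∈ interior P) (v : E) :
    ∃ n : ℕ, 1 ≤ n ∧ v + (n : ℝ) • a ∈ P := by
  have hlim : Filter.Tendsto (fun n : ℕ => ((n : ℝ)⁻¹) • v + a) Filter.atTop (nhds a) := by
    simpa using ((tendsto_inv_atTop_nhds_zero_nat (𝕜 := ℝ)).smul_const v).add_const a
  obtain ⟨n, hn, hn1⟩ := ((hlim.eventually (mem_interior_iff_mem_nhds.mp ha)).and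
    (Filter.eventually_ge_atTop 1)).exists
  refine ⟨n, hn1, ?_⟩
  have hn0 : (n : ℝ) ≠ 0 := by exact_mod_cast Nat.one_le_iff_ne_zero.mp hn1
  simpa [smul_add, smul_smul, hn0] using hP _ hn n n.cast_nonneg

/-- For a `P`-module `A` and `a ∈ Ω`, the sets `A + n • a` for `n ≥ 1` form a
decreasing sequence of closed sets with empty intersection. -/
theorem translates_decreasing_empty_inter
    (d : ℕ) (P A : Set (EuclideanSpace ℝ (Fin d)))
    (hPclosed : IsClosed P) (hPconvex : Convex ℝ P)
    (hPcone : ∀ x ∈ P, ∀ t : ℝ, 0 ≤ t → t • x ∈ P)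
    (hPspan : ∀ v : EuclideanSpace ℝ (Fin d), ∃ x ∈ P, ∃ y ∈ P, v = x - y)
    (hPpointed : P ∩ (-P) = {0})
    (hAclosed : IsClosed A) (hAproper : A ≠ Set.univ)
    (hAzero : (0 : EuclideanSpace ℝ (Fin d)) ∈ A)
    (hAmod : ∀ b ∈ A, ∀ p ∈ P, b + p ∈ A)
    (a : EuclideanSpace ℝ (Fin d)) (ha : a ∈ interior P) :
    (∀ n : ℕ, 1 ≤ n → IsClosed ((fun y => y + (n : ℝ) • a) '' A)) ∧
    (∀ n : ℕ, 1 ≤ n →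
      (fun y => y + ((n : ℝ) + 1) • a) '' A ⊆ (fun y => y + (n : ℝ) • a) '' A) ∧
    (⋂ (n : ℕ) (_ : 1 ≤ n), (fun y => y + (n : ℝ) • a) '' A) = ∅ := by
  refine ⟨fun n _ => (Homeomorph.addRight ((n : ℝ) • a)).isClosedMap A hAclosed, ?_, ?_⟩
  · rintro n - _ ⟨y, hy, rfl⟩
    refine ⟨y + a, hAmod y hy a (interior_subset ha), ?_⟩
    module
  · refine Set.eq_empty_of_forall_notMem fun x hx => hAproper ?_
    refine Set.eq_univ_of_forall fun z => ?_
    obtain ⟨n, hn, hmem⟩ := exists_nat_add_smul_mem_of_mem_interior hPcone ha (z - x)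
    obtain ⟨y, hy, rfl⟩ := Set.mem_iInter₂.mp hx n hn
    convert hAmod y hy _ hmem using 1
    module
end

section
/- Let A be a P-module in ℝ^d and let a ∈ Ω. Then the map ∂A × (0,∞) ∋ (x,s) ↦ x + sa ∈ Int(A) is a homeomorphism (in particular it is a well-defined bijection onto Int(A), and both it and its inverse are continuous). -/
open MeasureTheory

section ExitTime

variable {E : Type*} [NormedAddCommGroup E] [NormedSpace ℝ E]

/-- Moving along an interior direction of a cone absorbs any vector, at a rate linear in its
norm. -/
theorem exists_add_smul_mem_of_mem_interior_cone {P : Set E}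
    (hcone : ∀ x ∈ P, ∀ t : ℝ, 0 ≤ t → t • x ∈ P) {a : E} (ha : a ∈ interior P) :
    ∃ K : NNReal, ∀ (v : E) (t : ℝ), K * ‖v‖ ≤ t → v + t • a ∈ P := by
  obtain ⟨r, hr, hball⟩ := Metric.nhds_basis_closedBall.mem_iff.1 (mem_interior_iff_mem_nhds.1 ha)
  refine ⟨⟨r⁻¹, by positivity⟩, fun v t ht => ?_⟩
  have hvt : ‖v‖ ≤ r * t := (inv_mul_le_iff₀ hr).1 ht
  have ht0 : 0 ≤ t := (mul_nonneg_iff_of_pos_left hr).1 ((norm_nonneg v).trans hvt)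
  rcases ht0.eq_or_lt with rfl | htpos
  · obtain rfl : v = 0 := norm_le_zero_iff.1 (by simpa using hvt)
    simpa using hcone a (interior_subset ha) 0 le_rfl
  · have hmem : a + t⁻¹ • v ∈ P := hball (by
      rw [mem_closedBall_iff_norm, add_sub_cancel_left, norm_smul, norm_inv,
        Real.norm_of_nonneg ht0, inv_mul_le_iff₀ htpos, mul_comm]
      exact hvt)
    have := hcone _ hmem t ht0
    rwa [smul_add, smul_inv_smul₀ htpos.ne', add_comm] at this

/-- The time `τ y` at which the ray from `y` in direction `-a` leaves a closed set `A` stable under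
translation by a cone containing `a` in its interior is finite and depends continuously on `y`. -/
theorem exists_continuous_exitTime {P A : Set E}
    (hcone : ∀ x ∈ P, ∀ t : ℝ, 0 ≤ t → t • x ∈ P) (hclosed : IsClosed A) (hne : A.Nonempty)
    (hproper : A ≠ Set.univ) (hmod : ∀ b ∈ A, ∀ p ∈ P, b + p ∈ A)
    {a : E} (ha : a ∈ interior P) :
    ∃ τ : E → ℝ, Continuous τ ∧ ∀ y s, y - s • a ∈ A ↔ s ≤ τ y := by
  obtain ⟨K, hK⟩ := exists_add_smul_mem_of_mem_interior_cone hcone ha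
  have hshift : ∀ y z : E, ∀ s t : ℝ, y - s • a ∈ A → K * ‖z - y‖ ≤ s - t → z - t • a ∈ A := by
    intro y z s t hy hst
    convert hmod _ hy _ (hK (z - y) (s - t) hst) using 1
    module
  have hexit : ∀ y, ∃ t, ∀ s : ℝ, y - s • a ∈ A ↔ s ≤ t := by
    intro y
    obtain ⟨b, hb⟩ := hne
    obtain ⟨z, hz⟩ := (Set.ne_univ_iff_exists_notMem A).1 hproper
    let S : Set ℝ := {s | y - s • a ∈ A}
    have hS : S.Nonempty :=
      ⟨-(K * ‖y - b‖), hshift b y 0 _ (by simpa using hb) (by simp)⟩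
    have hbdd : BddAbove S := by
      refine ⟨K * ‖z - y‖, fun s hs => le_of_not_gt fun hlt => hz ?_⟩
      simpa using hshift y z s 0 hs (by simpa using hlt.le)
    have hScl : IsClosed S := hclosed.preimage (by fun_prop)
    refine ⟨sSup S, fun s => ⟨fun hs => le_csSup hbdd hs, fun hs => ?_⟩⟩
    exact hshift y y _ s (hScl.csSup_mem hS hbdd) (by simpa using hs)
  choose τ hτ using hexit
  refine ⟨τ, (LipschitzWith.of_le_add_mul K fun y z => ?_).continuous, hτ⟩
  have hle := (hτ z _).1 (hshift y z (τ y) (τ y - K * dist y z) ((hτ y _).2 le_rfl)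
    (by rw [← dist_eq_norm, dist_comm]; simp))
  linarith

end ExitTime

/-- For a `P`-module `A` and `a ∈ Ω`, the map
`∂A × (0,∞) ∋ (x,s) ↦ x + s • a ∈ Int(A)` is a homeomorphism. -/
theorem boundary_param_homeomorph
    (d : ℕ) (P A : Set (EuclideanSpace ℝ (Fin d)))
    (hPclosed : IsClosed P) (hPconvex : Convex ℝ P)
    (hPcone : ∀ x ∈ P, ∀ t : ℝ, 0 ≤ t → t • x ∈ P)
    (hPspan : ∀ v : EuclideanSpace ℝ (Fin d), ∃ x ∈ P, ∃ y ∈ P, v = x - y)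
    (hPpointed : P ∩ (-P) = {0})
    (hAclosed : IsClosed A) (hAproper : A ≠ Set.univ)
    (hAzero : (0 : EuclideanSpace ℝ (Fin d)) ∈ A)
    (hAmod : ∀ b ∈ A, ∀ p ∈ P, b + p ∈ A)
    (a : EuclideanSpace ℝ (Fin d)) (ha : a ∈ interior P) :
    ∃ h : ↥(frontier A ×ˢ Set.Ioi (0:ℝ)) ≃ₜ ↥(interior A),
      ∀ p : ↥(frontier A ×ˢ Set.Ioi (0:ℝ)),
        (h p : EuclideanSpace ℝ (Fin d)) =
          (p : EuclideanSpace ℝ (Fin d) × ℝ).1 + (p : EuclideanSpace ℝ (Fin d) × ℝ).2 • a := by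
  obtain ⟨τ, hτc, hτ⟩ := exists_continuous_exitTime hPcone hAclosed ⟨0, hAzero⟩ hAproper hAmod ha
  have hmemA : ∀ y, y ∈ A ↔ 0 ≤ τ y := fun y => by simpa using hτ y 0
  have hτadd : ∀ y s, τ (y + s • a) = τ y + s := by
    intro y s
    refine eq_of_forall_le_iff fun t => ?_
    rw [← hτ, ← sub_le_iff_le_add, ← hτ]
    congr! 1
    module
  have hint : ∀ y, y ∈ interior A ↔ 0 < τ y := by
    intro y
    refine ⟨fun hy => ?_, fun hy => ?_⟩
    · have hev : ∀ᶠ s : ℝ in nhds 0, y - s • a ∈ A := by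
        have hcont : Continuous fun s : ℝ => y - s • a := by fun_prop
        exact hcont.continuousAt.eventually_mem (by simpa using mem_interior_iff_mem_nhds.1 hy)
      obtain ⟨s, hs, hspos⟩ := ((hev.filter_mono nhdsWithin_le_nhds).and
        (self_mem_nhdsWithin : Set.Ioi (0 : ℝ) ∈ nhdsWithin 0 (Set.Ioi 0))).exists
      exact lt_of_lt_of_le hspos ((hτ y s).1 hs)
    · exact interior_maximal (fun z hz => (hmemA z).2 (le_of_lt hz))
        (isOpen_lt continuous_const hτc) hy
  have hfr : ∀ y, y ∈ frontier A ↔ τ y = 0 := by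
    intro y
    rw [hAclosed.frontier_eq, Set.mem_sdiff, hmemA, hint, not_lt, and_comm, le_antisymm_iff]
  have hτfr : ∀ p : ↥(frontier A ×ˢ Set.Ioi (0 : ℝ)), τ (p.1.1 + p.1.2 • a) = p.1.2 := by
    intro p
    rw [hτadd, (hfr _).1 p.2.1, zero_add]
  refine ⟨{
    toFun := fun p => ⟨p.1.1 + p.1.2 • a, (hint _).2 ((hτfr p).symm ▸ p.2.2)⟩
    invFun := fun y => ⟨(y.1 + (-τ y) • a, τ y), (hfr _).2 (by rw [hτadd, add_neg_cancel]),
      (hint _).1 y.2⟩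
    left_inv := fun p => by
      ext1
      ext1
      · simp [hτfr]
      · exact hτfr p
    right_inv := fun y => by
      ext1
      simp
    continuous_toFun := by fun_prop
    continuous_invFun := by fun_prop }, fun p => rfl⟩
end

section
/- Assume d ≥ 2 and let A be a P-module in ℝ^d. Then the boundary ∂A is an unbounded subset of ℝ^d. -/
open MeasureTheory

/-- In a real normed space of dimension `> 1`, the complement of a closed ball centred at the
origin is connected. -/
theorem isConnected_compl_closedBall_zero {E : Type*} [NormedAddCommGroup E] [NormedSpace ℝ E]
    (h : 1 < Module.rank ℝ E) {r : ℝ} (hr : 0 ≤ r) :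
    IsConnected (Metric.closedBall (0 : E) r)ᶜ := by
  have himage : (fun x : E => (1 + r / ‖x‖) • x) '' {0}ᶜ = (Metric.closedBall (0 : E) r)ᶜ := by
    ext y
    simp only [Set.mem_image, Set.mem_compl_iff, Set.mem_singleton_iff, mem_closedBall_zero_iff,
      not_le]
    constructor
    · rintro ⟨x, hx, rfl⟩
      have hx' : 0 < ‖x‖ := norm_pos_iff.mpr hx
      rw [norm_smul, Real.norm_of_nonneg (by positivity), add_mul, div_mul_cancel₀ _ hx'.ne']
      linarith
    · intro hy
      have hy' : 0 < ‖y‖ := hr.trans_lt hy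
      have hpos : 0 < 1 - r / ‖y‖ := sub_pos.mpr ((div_lt_one hy').mpr hy)
      refine ⟨(1 - r / ‖y‖) • y, smul_ne_zero hpos.ne' (norm_pos_iff.mp hy'), ?_⟩
      have hnorm : ‖(1 - r / ‖y‖) • y‖ = ‖y‖ - r := by
        rw [norm_smul, Real.norm_of_nonneg hpos.le, sub_mul, div_mul_cancel₀ _ hy'.ne', one_mul]
      have hsub : ‖y‖ - r ≠ 0 := (sub_pos.mpr hy).ne'
      rw [hnorm, smul_smul]
      convert one_smul ℝ y using 2
      field_simp
      ring
  rw [← himage]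
  refine (isConnected_compl_singleton_of_one_lt_rank h 0).image _ ?_
  refine (continuousOn_const.add (continuousOn_const.div continuousOn_id.norm ?_)).smul
    continuousOn_id
  exact fun x hx => norm_ne_zero_iff.mpr hx

/-- For every point `x` and every nonzero direction `p`, the ray from `x` along `p` leaves every
closed ball centred at the origin. -/
theorem exists_nonneg_add_smul_notMem_closedBall {E : Type*} [NormedAddCommGroup E]
    [NormedSpace ℝ E] (x : E) {p : E} (hp : p ≠ 0) (r : ℝ) :
    ∃ t : ℝ, 0 ≤ t ∧ x + t • p ∉ Metric.closedBall (0 : E) r := by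
  have hp' : 0 < ‖p‖ := norm_pos_iff.mpr hp
  refine ⟨(|r| + ‖x‖ + 1) / ‖p‖, by positivity, ?_⟩
  have hnorm : ‖((|r| + ‖x‖ + 1) / ‖p‖) • p‖ = |r| + ‖x‖ + 1 := by
    rw [norm_smul, Real.norm_of_nonneg (by positivity), div_mul_cancel₀ _ hp'.ne']
  rw [mem_closedBall_zero_iff, not_le]
  have htri := norm_le_add_norm_add' x (((|r| + ‖x‖ + 1) / ‖p‖) • p)
  linarith [le_abs_self r]

/-- For `d ≥ 2` and a `P`-module `A` in `ℝ^d`, the boundary `∂A` is unbounded. -/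
theorem frontier_unbounded
    (d : ℕ) (hd : 2 ≤ d) (P A : Set (EuclideanSpace ℝ (Fin d)))
    (hPclosed : IsClosed P) (hPconvex : Convex ℝ P)
    (hPcone : ∀ x ∈ P, ∀ t : ℝ, 0 ≤ t → t • x ∈ P)
    (hPspan : ∀ v : EuclideanSpace ℝ (Fin d), ∃ x ∈ P, ∃ y ∈ P, v = x - y)
    (hPpointed : P ∩ (-P) = {0})
    (hAclosed : IsClosed A) (hAproper : A ≠ Set.univ)
    (hAzero : (0 : EuclideanSpace ℝ (Fin d)) ∈ A)
    (hAmod : ∀ b ∈ A, ∀ p ∈ P, b + p ∈ A) :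
    ¬ Bornology.IsBounded (frontier A) := by
  intro hbounded
  obtain ⟨p, hpP, hp⟩ : ∃ p ∈ P, p ≠ 0 := by
    by_contra! hzero
    obtain ⟨x, hx, y, hy, hxy⟩ := hPspan (EuclideanSpace.single ⟨0, by lia⟩ 1)
    simp [hzero x hx, hzero y hy] at hxy
  obtain ⟨r, hr, hsub⟩ := hbounded.subset_closedBall_lt 0 0
  have hrank : 1 < Module.rank ℝ (EuclideanSpace ℝ (Fin d)) := by
    rw [← Module.finrank_eq_rank, finrank_euclideanSpace_fin]
    exact_mod_cast hd
  have hconn := (isConnected_compl_closedBall_zero hrank hr.le).isPreconnected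
  have hinterior : ∀ c ∈ (Metric.closedBall 0 r)ᶜ, c ∈ A → c ∈ interior A := by
    intro c hc hcA
    by_contra hcint
    exact hc (hsub (hAclosed.frontier_eq ▸ ⟨hcA, hcint⟩))
  have hcompl : (Metric.closedBall 0 r)ᶜ ⊆ A := by
    obtain ⟨t, ht, htr⟩ := exists_nonneg_add_smul_notMem_closedBall 0 hp r
    by_contra hnot
    obtain ⟨y, hy, hyA⟩ := Set.not_subset.mp hnot
    obtain ⟨z, -, hzint, hzA⟩ := hconn (interior A) Aᶜ isOpen_interior hAclosed.isOpen_compl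
      (fun c hc => (em (c ∈ A)).imp_left (hinterior c hc))
      ⟨_, htr, hinterior _ htr (hAmod 0 hAzero _ (hPcone p hpP t ht))⟩ ⟨y, hy, hyA⟩
    exact hzA (interior_subset hzint)
  refine hAproper (Set.eq_univ_of_forall fun x => ?_)
  obtain ⟨t, ht, htr⟩ := exists_nonneg_add_smul_notMem_closedBall x (neg_ne_zero.mpr hp) r
  simpa using hAmod _ (hcompl htr) _ (hPcone p hpP t ht)
end

section
/- Assume d ≥ 2, let A be a P-module in ℝ^d, and let a ∈ Ω. Then the set Int(A) \ (A + a) has infinite Lebesgue measure. -/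
open MeasureTheory

/-- If a cone contains the ball of radius `r` around `b`, then it contains the ball of radius
`N * r` around `N • b`. -/
lemma add_natCast_smul_mem_of_closedBall_subset {E : Type*} [NormedAddCommGroup E]
    [NormedSpace ℝ E] {P : Set E} (hPcone : ∀ x ∈ P, ∀ t : ℝ, 0 ≤ t → t • x ∈ P)
    {b : E} {r : ℝ} (hr : 0 ≤ r) (hball : Metric.closedBall b r ⊆ P) (N : ℕ) {v : E}
    (hv : ‖v‖ ≤ N * r) : v + (N : ℝ) • b ∈ P := by
  rcases Nat.eq_zero_or_pos N with rfl | hN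
  · have hv0 : v = 0 := by simpa using hv
    simpa [hv0] using hPcone b (hball (Metric.mem_closedBall_self hr)) 0 le_rfl
  · have hN' : (0 : ℝ) < N := by exact_mod_cast hN
    have hmem : b + (N : ℝ)⁻¹ • v ∈ P := by
      apply hball
      rw [mem_closedBall_iff_norm, add_sub_cancel_left, norm_smul, norm_inv, Real.norm_natCast,
        inv_mul_le_iff₀ hN']
      exact hv
    have h := hPcone _ hmem N hN'.le
    rwa [smul_add, smul_inv_smul₀ hN'.ne', add_comm] at h

/-- Every point `x` of the ball of radius `N * r` is moved by some multiple `m • b`, with `|m|`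
at most linear in `N`, into the strip `interior A \ (A + 2 • b)`. -/
lemma exists_int_add_smul_mem_strip {E : Type*} [NormedAddCommGroup E] [NormedSpace ℝ E]
    {P A : Set E} (hPcone : ∀ x ∈ P, ∀ t : ℝ, 0 ≤ t → t • x ∈ P)
    (hAzero : (0 : E) ∈ A) (hAmod : ∀ y ∈ A, ∀ p ∈ P, y + p ∈ A)
    {b z : E} {r : ℝ} (hr : 0 < r) (hball : Metric.closedBall b r ⊆ P) (hz : z ∉ A)
    {M N : ℕ} (hM : ‖z‖ ≤ M * r) {x : E} (hx : ‖x‖ ≤ N * r) :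
    ∃ m ∈ Finset.Icc (-(N + M + 1) : ℤ) (N + M + 1),
      x + (m : ℝ) • b ∈ interior A \ ((fun y => y + (2 : ℝ) • b) '' A) := by
  have hup : x + ((N : ℤ) : ℝ) • b ∈ A := by
    have h := hAmod 0 hAzero _
      (add_natCast_smul_mem_of_closedBall_subset hPcone hr.le hball N hx)
    simpa using h
  have hlow : ∀ k : ℤ, x + (k : ℝ) • b ∈ A → -((N : ℤ) + M) ≤ k := by
    intro k hk
    by_contra! hlt
    obtain ⟨K, hK⟩ : ∃ K : ℕ, k = -(K : ℤ) := ⟨k.natAbs, by omega⟩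
    have hKge : N + M ≤ K := by omega
    have hKr : (N : ℝ) + M ≤ K := by exact_mod_cast hKge
    have hn : ‖z - x‖ ≤ K * r := by
      have := norm_sub_le z x
      nlinarith
    have h := hAmod _ hk _
      (add_natCast_smul_mem_of_closedBall_subset hPcone hr.le hball K hn)
    refine hz ?_
    convert h using 1
    rw [hK]
    push_cast
    module
  obtain ⟨k, hk, hmin⟩ := Int.exists_least_of_bdd (P := fun k : ℤ => x + (k : ℝ) • b ∈ A)
    ⟨_, hlow⟩ ⟨_, hup⟩
  refine ⟨k + 1, ?_, ?_, ?_⟩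
  · have h₁ := hlow k hk
    have h₂ := hmin _ hup
    rw [Finset.mem_Icc]
    omega
  · rw [mem_interior_iff_mem_nhds]
    refine Filter.mem_of_superset (Metric.closedBall_mem_nhds _ hr) fun w hw => ?_
    have hwP : w - (x + (k : ℝ) • b) ∈ P := by
      apply hball
      rw [mem_closedBall_iff_norm] at hw ⊢
      convert hw using 2
      push_cast
      module
    simpa using hAmod _ hk _ hwP
  · rintro ⟨y, hy, hyx⟩
    have hy' : y = x + ((k - 1 : ℤ) : ℝ) • b := by
      rw [eq_sub_of_add_eq hyx]
      push_cast
      module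
    have := hmin (k - 1) (hy' ▸ hy)
    omega

/-- For `d ≥ 2`, a `P`-module `A` in `ℝ^d` and `a ∈ Ω`, the set
`Int(A) \ (A + a)` has infinite Lebesgue measure. -/
theorem strip_infinite_measure
    (d : ℕ) (hd : 2 ≤ d) (P A : Set (EuclideanSpace ℝ (Fin d)))
    (hPclosed : IsClosed P) (hPconvex : Convex ℝ P)
    (hPcone : ∀ x ∈ P, ∀ t : ℝ, 0 ≤ t → t • x ∈ P)
    (hPspan : ∀ v : EuclideanSpace ℝ (Fin d), ∃ x ∈ P, ∃ y ∈ P, v = x - y)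
    (hPpointed : P ∩ (-P) = {0})
    (hAclosed : IsClosed A) (hAproper : A ≠ Set.univ)
    (hAzero : (0 : EuclideanSpace ℝ (Fin d)) ∈ A)
    (hAmod : ∀ b ∈ A, ∀ p ∈ P, b + p ∈ A)
    (a : EuclideanSpace ℝ (Fin d)) (ha : a ∈ interior P) :
    volume (interior A \ ((fun y => y + a) '' A)) = ⊤ := by
  obtain ⟨z, hz⟩ := (Set.ne_univ_iff_exists_notMem A).1 hAproper
  obtain ⟨ρ, hρ, hρP⟩ := Metric.nhds_basis_closedBall.mem_iff.1 (mem_interior_iff_mem_nhds.1 ha)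
  obtain ⟨b, rfl⟩ : ∃ b, a = (2 : ℝ) • b := ⟨(2 : ℝ)⁻¹ • a, by simp⟩
  obtain ⟨r, rfl⟩ : ∃ r, ρ = 2 * r := ⟨ρ / 2, by ring⟩
  have hr : 0 < r := by linarith
  have hball : Metric.closedBall b r ⊆ P := by
    intro w hw
    have h2 : (2 : ℝ) • w ∈ P := by
      apply hρP
      rw [mem_closedBall_iff_norm] at hw ⊢
      rw [← smul_sub, norm_smul, Real.norm_two]
      linarith
    simpa using hPcone _ h2 2⁻¹ (by norm_num)
  obtain ⟨M, hM⟩ := exists_nat_ge (‖z‖ / r)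
  rw [div_le_iff₀ hr] at hM
  set S := interior A \ ((fun y => y + (2 : ℝ) • b) '' A)
  by_contra hS
  have hcover : ∀ N : ℕ, volume (Metric.closedBall (0 : EuclideanSpace ℝ (Fin d)) (N * r)) ≤
      ((2 * (N + M + 1) + 1 : ℕ) : ENNReal) * volume S := by
    intro N
    have hsub : Metric.closedBall (0 : EuclideanSpace ℝ (Fin d)) (N * r) ⊆
        ⋃ m ∈ Finset.Icc (-(N + M + 1) : ℤ) (N + M + 1), (fun x => x + (m : ℝ) • b) ⁻¹' S := by
      intro x hx
      obtain ⟨m, hm, hmS⟩ := exists_int_add_smul_mem_strip hPcone hAzero hAmod hr hball hz hM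
        (mem_closedBall_zero_iff.1 hx)
      exact Set.mem_biUnion hm hmS
    refine (measure_mono hsub).trans ((measure_biUnion_finset_le _ _).trans ?_)
    simp only [measure_preimage_add_right, Finset.sum_const, nsmul_eq_mul, Int.card_Icc]
    gcongr
    omega
  set c := volume.real (Metric.closedBall (0 : EuclideanSpace ℝ (Fin d)) r) with hc
  have hcpos : 0 < c := ENNReal.toReal_pos
    (Metric.measure_closedBall_pos volume _ hr).ne' measure_closedBall_lt_top.ne
  have hgrowth : ∀ N : ℕ, (N : ℝ) ^ d * c ≤ (2 * (N + M + 1) + 1) * volume.real S := by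
    intro N
    have h := ENNReal.toReal_mono (ENNReal.mul_ne_top (ENNReal.natCast_ne_top _) hS) (hcover N)
    rw [Measure.addHaar_closedBall_mul _ _ (Nat.cast_nonneg N) hr.le] at h
    rw [ENNReal.toReal_mul, ENNReal.toReal_mul, ENNReal.toReal_natCast] at h
    simpa [Measure.real, hc] using h
  obtain ⟨n, hn⟩ := exists_nat_gt ((2 * M + 5) * volume.real S / c)
  rw [div_lt_iff₀ hcpos] at hn
  have hs : 0 ≤ volume.real S := measureReal_nonneg
  have hN1 : (1 : ℝ) ≤ (n + 1 : ℕ) := by simp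
  have hlt : (2 * M + 5) * volume.real S < (n + 1 : ℕ) * c := by push_cast; linarith
  have hg := hgrowth (n + 1)
  set x : ℝ := ((n + 1 : ℕ) : ℝ)
  have hpow : x ^ 2 * c ≤ x ^ d * c := by gcongr
  have hlin : (2 * (x + M + 1) + 1) * volume.real S ≤ x * ((2 * M + 5) * volume.real S) := by
    rw [← mul_assoc]
    gcongr
    have : (0 : ℝ) ≤ M := Nat.cast_nonneg M
    nlinarith
  nlinarith [mul_lt_mul_of_pos_left hlt (by linarith : 0 < x)]
end

section
/- Assume d ≥ 2, let A be a P-module in ℝ^d, and let V = {V_x}_{x∈P} be the isometric representation of P on L²(A) associated to A of multiplicity 1. If ξ = {ξ_x}_{x∈P} is an additive cocycle of V, then ξ_x = 0 for every x ∈ P. -/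
open MeasureTheory

/-- The squared modulus of an `L²` function on `A`, extended by zero outside `A`. -/
noncomputable def squareDensity {E : Type*} [MeasureSpace E] (A : Set E)
    (f : Lp ℂ 2 (volume.restrict A : Measure E)) : E → ENNReal :=
  A.indicator fun z => ‖f z‖ₑ ^ 2

theorem lintegral_squareDensity_ne_top {E : Type*} [MeasureSpace E] {A : Set E}
    (hA : MeasurableSet A) (f : Lp ℂ 2 (volume.restrict A : Measure E)) :
    ∫⁻ z, squareDensity A f z ≠ ⊤ := by
  rw [squareDensity, lintegral_indicator hA]
  have h := (lintegral_rpow_enorm_lt_top_of_eLpNorm_lt_top (by norm_num) (by norm_num)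
    (Lp.memLp f).2).ne
  simpa using h

theorem eq_zero_of_lintegral_squareDensity_eq_zero {E : Type*} [MeasureSpace E] {A : Set E}
    (hA : MeasurableSet A) (f : Lp ℂ 2 (volume.restrict A : Measure E))
    (h : ∫⁻ z, squareDensity A f z = 0) : f = 0 := by
  rw [squareDensity, lintegral_indicator hA,
    lintegral_eq_zero_iff' ((Lp.aestronglyMeasurable f).enorm.pow_const 2)] at h
  refine Lp.ext ?_
  filter_upwards [h, Lp.coeFn_zero ℂ 2 (volume.restrict A)] with z hz h0
  rw [h0]
  simpa using hz

theorem aemeasurable_squareDensity {E : Type*} [MeasureSpace E] {A : Set E}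
    (hA : MeasurableSet A) (f : Lp ℂ 2 (volume.restrict A : Measure E)) :
    AEMeasurable (squareDensity A f) :=
  (aemeasurable_indicator_iff hA).2 ((Lp.aestronglyMeasurable f).enorm.pow_const 2)

/-- A property holding a.e. on `A` holds at `z - x` for a.e. `z` with `z - x ∈ A`. -/
theorem ae_sub_mem_of_ae_restrict {E : Type*} [NormedAddCommGroup E] [MeasureSpace E]
    [BorelSpace E] [SecondCountableTopology E] [(volume : Measure E).IsAddHaarMeasure]
    {A : Set E} (hA : MeasurableSet A) {q : E → Prop}
    (hq : ∀ᵐ z ∂(volume.restrict A), q z) (x : E) :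
    ∀ᵐ z : E, z - x ∈ A → q (z - x) :=
  (measurePreserving_sub_right volume x).quasiMeasurePreserving.ae
    ((ae_restrict_iff' hA).1 hq)

/-- A vector in the kernel of the adjoint of the truncated translation by `x` vanishes a.e. on
`A + x`. -/
theorem ae_eq_zero_of_adjoint_eq_zero {E : Type*} [NormedAddCommGroup E] [MeasureSpace E]
    [BorelSpace E] [SecondCountableTopology E] [(volume : Measure E).IsAddHaarMeasure]
    {A : Set E} (hA : MeasurableSet A) {x : E} (hx : ∀ b ∈ A, b + x ∈ A)
    {T : Lp ℂ 2 (volume.restrict A : Measure E) →L[ℂ] Lp ℂ 2 (volume.restrict A : Measure E)}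
    (hT : ∀ f, ⇑(T f) =ᵐ[volume.restrict A] fun y => A.indicator (⇑f) (y - x))
    {g : Lp ℂ 2 (volume.restrict A : Measure E)}
    (hg : ContinuousLinearMap.adjoint T g = 0) :
    ∀ᵐ z ∂(volume.restrict A), z - x ∈ A → g z = 0 := by
  have hmp : MeasurePreserving (fun z => z + x) (volume.restrict A)
      (volume.restrict ((fun z => z - x) ⁻¹' A)) := by
    have := (measurePreserving_add_right (volume : Measure E) x).restrict_preimage
      (s := (fun z => z - x) ⁻¹' A) (hA.preimage (measurable_sub_const x))
    simpa [← Set.preimage_comp, Function.comp_def] using this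
  have hsub : (fun z => z - x) ⁻¹' A ⊆ A := fun z hz => by simpa using hx _ hz
  have hmem : MemLp (fun z => g (z + x)) 2 (volume.restrict A) :=
    ((Lp.memLp g).mono_measure (Measure.restrict_mono hsub le_rfl)).comp_measurePreserving hmp
  set f := hmem.toLp
  have hTf : ∀ᵐ z ∂(volume.restrict A), (z - x ∈ A → T f z = g z) ∧
      (z - x ∉ A → T f z = 0) := by
    filter_upwards [hT f,
      ae_restrict_of_ae (ae_sub_mem_of_ae_restrict hA hmem.coeFn_toLp x)] with z h1 h2
    refine ⟨fun hz => ?_, fun hz => ?_⟩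
    · rw [h1, Set.indicator_of_mem hz, h2 hz, sub_add_cancel]
    · rw [h1, Set.indicator_of_notMem hz]
  have horth : inner ℂ g (T f) = 0 := by
    rw [← ContinuousLinearMap.adjoint_inner_left, hg, inner_zero_left]
  have hself : inner ℂ (T f) (T f) = inner ℂ g (T f) := by
    rw [L2.inner_def, L2.inner_def]
    refine integral_congr_ae ?_
    filter_upwards [hTf] with z hz
    by_cases h : z - x ∈ A
    · rw [hz.1 h]
    · rw [hz.2 h, inner_zero_right, inner_zero_right]
  have hzero : T f = 0 := inner_self_eq_zero.1 (hself.trans horth)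
  filter_upwards [hTf, Lp.coeFn_zero ℂ 2 (volume.restrict A)] with z h1 h0 hz
  rw [← h1.1 hz, hzero, h0, Pi.zero_apply]

/-- If `g` vanishes a.e. on `A + x`, then the density of `g + T f`, with `T` the truncated
translation by `x`, is the sum of the density of `g` and the translated density of `f`. -/
theorem setLIntegral_squareDensity_add {E : Type*} [NormedAddCommGroup E] [MeasureSpace E]
    [BorelSpace E] [SecondCountableTopology E] [(volume : Measure E).IsAddHaarMeasure]
    {A : Set E} (hA : MeasurableSet A) {x : E} (hx : ∀ b ∈ A, b + x ∈ A)
    {T : Lp ℂ 2 (volume.restrict A : Measure E) →L[ℂ] Lp ℂ 2 (volume.restrict A : Measure E)}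
    (hT : ∀ f, ⇑(T f) =ᵐ[volume.restrict A] fun y => A.indicator (⇑f) (y - x))
    {g : Lp ℂ 2 (volume.restrict A : Measure E)}
    (hg : ContinuousLinearMap.adjoint T g = 0)
    (f : Lp ℂ 2 (volume.restrict A : Measure E)) (S : Set E) :
    ∫⁻ z in S, squareDensity A (g + T f) z =
      (∫⁻ z in S, squareDensity A g z) +
        ∫⁻ z in (fun z => z + x) ⁻¹' S, squareDensity A f z := by
  have hpt : squareDensity A (g + T f) =ᵐ[volume]
      fun z => squareDensity A g z + squareDensity A f (z - x) := by
    filter_upwards [(ae_restrict_iff' hA).1 (Lp.coeFn_add g (T f)),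
      (ae_restrict_iff' hA).1 (hT f),
      (ae_restrict_iff' hA).1 (ae_eq_zero_of_adjoint_eq_zero hA hx hT hg)] with z h1 h2 h3
    by_cases hz : z ∈ A
    · have hsum : (g + T f) z = g z + A.indicator (⇑f) (z - x) := by
        rw [h1 hz, Pi.add_apply, h2 hz]
      simp only [squareDensity, Set.indicator_of_mem hz, hsum]
      by_cases hzx : z - x ∈ A
      · simp [hzx, h3 hz hzx]
      · simp [hzx]
    · have hzx : z - x ∉ A := fun h => hz (by simpa using hx _ h)
      simp [squareDensity, hz, hzx]
  rw [lintegral_congr_ae (ae_restrict_of_ae hpt),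
    lintegral_add_left' (aemeasurable_squareDensity hA g).restrict]
  congr 1
  rw [← (measurePreserving_add_right (volume : Measure E) x).setLIntegral_comp_preimage_emb
    (measurableEmbedding_addRight x) (fun z => squareDensity A f (z - x)) S]
  simp

/-- Given `e`, a spanning set contains a vector `p` separated from `e` by a linear functional
vanishing on `e`. -/
theorem exists_dual_eq_zero_eq_one {E : Type*} [NormedAddCommGroup E] [InnerProductSpace ℝ E]
    [FiniteDimensional ℝ E] (hE : 2 ≤ Module.finrank ℝ E) {P : Set E}
    (hP : ∀ v : E, ∃ x ∈ P, ∃ y ∈ P, v = x - y) (e : E) :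
    ∃ p ∈ P, ∃ ψ : E →L[ℝ] ℝ, ψ e = 0 ∧ ψ p = 1 := by
  obtain ⟨w, hw, hw0⟩ : ∃ w ∈ (Submodule.span ℝ {e})ᗮ, w ≠ 0 := by
    refine Submodule.exists_mem_ne_zero_of_ne_bot fun h => ?_
    have h1 := Submodule.finrank_add_finrank_orthogonal (Submodule.span ℝ {e})
    have h2 : Module.finrank ℝ (Submodule.span ℝ {e}) ≤ 1 := by
      simpa using finrank_span_le_card (R := ℝ) {e}
    rw [h, finrank_bot] at h1
    omega
  have hwe : inner ℝ w e = 0 :=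
    Submodule.mem_orthogonal' _ _ |>.1 hw e (Submodule.mem_span_singleton_self e)
  obtain ⟨p, hp, hpw⟩ : ∃ p ∈ P, inner ℝ w p ≠ 0 := by
    by_contra! h
    obtain ⟨a, ha, b, hb, hab⟩ := hP w
    refine hw0 (inner_self_eq_zero (𝕜 := ℝ).1 ?_)
    calc inner ℝ w w = inner ℝ w (a - b) := by rw [← hab]
      _ = 0 := by rw [inner_sub_right, h a ha, h b hb, sub_zero]
  exact ⟨p, hp, (inner ℝ w p)⁻¹ • innerSL ℝ w, by simp [hwe], by simp [hpw]⟩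

/-- For `d ≥ 2` and a `P`-module `A`, the isometric representation `V` of `P` on
`L²(A)` associated to `A` of multiplicity one (given by `(V_x f)(y) = f (y - x)` if
`y - x ∈ A` and `0` otherwise) admits no nonzero additive cocycle: any additive
cocycle `ξ` of `V` satisfies `ξ_x = 0` for all `x ∈ P`. -/
theorem no_additive_cocycle_multiplicity_one
    (d : ℕ) (hd : 2 ≤ d) (P A : Set (EuclideanSpace ℝ (Fin d)))
    (hPclosed : IsClosed P) (hPconvex : Convex ℝ P)
    (hPcone : ∀ x ∈ P, ∀ t : ℝ, 0 ≤ t → t • x ∈ P)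
    (hPspan : ∀ v : EuclideanSpace ℝ (Fin d), ∃ x ∈ P, ∃ y ∈ P, v = x - y)
    (hPpointed : P ∩ (-P) = {0})
    (hAclosed : IsClosed A) (hAproper : A ≠ Set.univ)
    (hAzero : (0 : EuclideanSpace ℝ (Fin d)) ∈ A)
    (hAmod : ∀ b ∈ A, ∀ p ∈ P, b + p ∈ A)
    (V : EuclideanSpace ℝ (Fin d) →
      (Lp ℂ 2 (volume.restrict A) →L[ℂ] Lp ℂ 2 (volume.restrict A)))
    (hV : ∀ x ∈ P, ∀ f : Lp ℂ 2 (volume.restrict A),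
      ⇑(V x f) =ᵐ[volume.restrict A] fun y => A.indicator (⇑f) (y - x))
    (ξ : EuclideanSpace ℝ (Fin d) → Lp ℂ 2 (volume.restrict A))
    (hadd : ∀ x ∈ P, ∀ y ∈ P, ξ (x + y) = ξ x + V x (ξ y))
    (horth : ∀ x ∈ P, ContinuousLinearMap.adjoint (V x) (ξ x) = 0)
    (hcont : ContinuousOn ξ P) :
    ∀ x ∈ P, ξ x = 0 := by
  intro e he
  have hA : MeasurableSet A := hAclosed.measurableSet
  obtain ⟨p, hp, ψ, hψe, hψp⟩ := exists_dual_eq_zero_eq_one (by simpa using hd) hPspan e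
  have key : ∀ x ∈ P, ∀ y ∈ P, ∀ S : Set (EuclideanSpace ℝ (Fin d)),
      ∫⁻ z in S, squareDensity A (ξ (x + y)) z =
        (∫⁻ z in S, squareDensity A (ξ x) z) +
          ∫⁻ z in (fun z => z + x) ⁻¹' S, squareDensity A (ξ y) z := fun x hx y hy S => by
    rw [hadd x hx y hy]
    exact setLIntegral_squareDensity_add hA (fun b hb => hAmod b hb x hx) (hV x hx)
      (horth x hx) (ξ y) S
  have hfin : ∀ x, ∀ S : Set (EuclideanSpace ℝ (Fin d)),
      ∫⁻ z in S, squareDensity A (ξ x) z ≠ ⊤ := fun x S =>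
    ne_top_of_le_ne_top (lintegral_squareDensity_ne_top hA (ξ x)) (setLIntegral_le_lintegral _ _)
  let S : ℤ → Set (EuclideanSpace ℝ (Fin d)) := fun k => (fun z => ⌊ψ z⌋) ⁻¹' {k}
  have hS : ∀ k, MeasurableSet (S k) := fun k =>
    (Int.measurable_floor.comp ψ.continuous.measurable) (measurableSet_singleton k)
  have hstep : ∀ k, ∫⁻ z in S (k + 1), squareDensity A (ξ e) z =
      ∫⁻ z in S k, squareDensity A (ξ e) z := fun k => by
    have h1 := key e he p hp (S (k + 1))
    have h2 := key p hp e he (S (k + 1))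
    have he' : (fun z => z + e) ⁻¹' S (k + 1) = S (k + 1) := by ext z; simp [S, hψe]
    have hp' : (fun z => z + p) ⁻¹' S (k + 1) = S k := by ext z; simp [S, hψp]
    rw [add_comm p e, h1, he', hp', add_comm] at h2
    exact (ENNReal.add_right_inj (hfin p _)).1 h2
  have hconst : ∀ k, ∫⁻ z in S k, squareDensity A (ξ e) z =
      ∫⁻ z in S 0, squareDensity A (ξ e) z := fun k => by
    induction k using Int.induction_on with
    | zero => rfl
    | succ n ih => rw [hstep, ih]
    | pred n ih => rw [← hstep, sub_add_cancel, ih]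
  have hsum : ∫⁻ z, squareDensity A (ξ e) z =
      ∑' _ : ℤ, ∫⁻ z in S 0, squareDensity A (ξ e) z := by
    rw [← setLIntegral_univ, ← tsum_congr hconst, ← lintegral_iUnion hS]
    · congr 2
      ext z
      simp [S]
    · exact fun i j hij => Set.disjoint_left.2 fun z hi hj => hij (hi.symm.trans hj)
  have hzero : ∫⁻ z in S 0, squareDensity A (ξ e) z = 0 := by
    by_contra h
    exact lintegral_squareDensity_ne_top hA (ξ e)
      (hsum.trans (ENNReal.tsum_const_eq_top_of_ne_zero h))
  refine eq_zero_of_lintegral_squareDensity_eq_zero hA _ ?_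
  rw [hsum, hzero, tsum_zero]
end

section
/- Assume d ≥ 2, let A be a P-module in ℝ^d, let K be a separable Hilbert space, and let V = {V_x}_{x∈P} be the isometric representation of P on L²(A; K) defined by (V_x f)(y) = f(y − x) if y − x ∈ A and (V_x f)(y) = 0 otherwise. If ξ = {ξ_x}_{x∈P} is an additive cocycle of V, then ξ_x = 0 for every x ∈ P. -/
open MeasureTheory Set Filter Topology
open scoped ENNReal

section Cone

variable {E : Type*} [NormedAddCommGroup E]

/-- A convex cone is closed under addition. -/
lemma add_mem_of_convex_cone [NormedSpace ℝ E] {P : Set E} (hconv : Convex ℝ P)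
    (hcone : ∀ x ∈ P, ∀ t : ℝ, 0 ≤ t → t • x ∈ P) {x y : E} (hx : x ∈ P) (hy : y ∈ P) :
    x + y ∈ P := by
  have h := hconv (hcone x hx 2 (by norm_num)) (hcone y hy 2 (by norm_num))
    (a := 1 / 2) (b := 1 / 2) (by norm_num) (by norm_num) (by norm_num)
  simpa [smul_smul] using h

/-- A convex set whose differences exhaust a finite-dimensional space contains a ball. -/
lemma exists_ball_subset_of_spanning [NormedSpace ℝ E] [FiniteDimensional ℝ E] {P : Set E}
    (hconv : Convex ℝ P) (hspan : ∀ v : E, ∃ x ∈ P, ∃ y ∈ P, v = x - y) :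
    ∃ e : E, ∃ ρ > 0, Metric.ball e ρ ⊆ P := by
  have hne : P.Nonempty := by
    obtain ⟨x, hx, -⟩ := hspan 0
    exact ⟨x, hx⟩
  have hint : (interior P).Nonempty := by
    rw [hconv.interior_nonempty_iff_affineSpan_eq_top,
      AffineSubspace.affineSpan_eq_top_iff_vectorSpan_eq_top_of_nonempty _ _ _ hne, eq_top_iff]
    intro v _
    obtain ⟨x, hx, y, hy, rfl⟩ := hspan v
    exact vsub_mem_vectorSpan ℝ hx hy
  obtain ⟨e, he⟩ := hint
  obtain ⟨ρ, hρ, h⟩ := Metric.mem_nhds_iff.mp (mem_interior_iff_mem_nhds.mp he)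
  exact ⟨e, ρ, hρ, h⟩

/-- Every line in an interior direction of `P` leaves the module `A` within a step of length
one half. -/
lemma exists_mem_and_sub_half_notMem [NormedSpace ℝ E] {P A : Set E}
    (hcone : ∀ x ∈ P, ∀ t : ℝ, 0 ≤ t → t • x ∈ P) (hA : A ≠ univ) (hA0 : (0 : E) ∈ A)
    (hmod : ∀ b ∈ A, ∀ p ∈ P, b + p ∈ A) {e : E} {ρ : ℝ} (hρ : 0 < ρ)
    (he : Metric.ball e ρ ⊆ P) (v : E) :
    ∃ t : ℝ, v + t • e ∈ A ∧ v + t • e - (1 / 2 : ℝ) • e ∉ A := by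
  have large : ∀ v : E, ∃ T : ℝ, ∀ t ≥ T, v + t • e ∈ P := by
    intro v
    refine ⟨‖v‖ / ρ + 1, fun t ht => ?_⟩
    have h0 : 0 ≤ ‖v‖ / ρ := by positivity
    have ht0 : 0 < t := by linarith
    have hmem : e + t⁻¹ • v ∈ P := by
      apply he
      rw [Metric.mem_ball, dist_eq_norm, add_sub_cancel_left, norm_smul, Real.norm_eq_abs,
        abs_of_pos (inv_pos.mpr ht0), inv_mul_lt_iff₀ ht0]
      have : ‖v‖ / ρ < t := by linarith
      rwa [div_lt_iff₀ hρ] at this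
    have := hcone _ hmem t ht0.le
    rwa [smul_add, smul_smul, mul_inv_cancel₀ ht0.ne', one_smul, add_comm] at this
  obtain ⟨T, hT⟩ := large v
  obtain ⟨u, hu⟩ := (ne_univ_iff_exists_notMem A).mp hA
  obtain ⟨T', hT'⟩ := large (u - v)
  have hex : ∃ n : ℕ, v + (T - n / 2) • e ∉ A := by
    obtain ⟨n, hn⟩ := exists_nat_ge (2 * (T' + T))
    refine ⟨n, fun h => hu ?_⟩
    have := hmod _ h _ (hT' (-(T - n / 2)) (by linarith))
    convert this using 1
    module
  classical
  have hstart : v + T • e ∈ A := by simpa using hmod 0 hA0 _ (hT T le_rfl)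
  have hspec := Nat.find_spec hex
  have hmin := fun m => Nat.find_min hex (m := m)
  generalize Nat.find hex = n at hspec hmin
  cases n with
  | zero => exact absurd hstart (by simpa using hspec)
  | succ n =>
    refine ⟨T - n / 2, not_not.mp (hmin n n.lt_succ_self), fun h => hspec ?_⟩
    convert h using 1
    push_cast
    module

/-- For a module `A` over a spanning cone `P` in dimension at least two, some `A \ (A + x)` with
`x ∈ P` contains infinitely many disjoint balls of equal radius. -/
lemma exists_disjoint_balls [InnerProductSpace ℝ E] [FiniteDimensional ℝ E]
    (hdim : 2 ≤ Module.finrank ℝ E) {P A : Set E} (hconv : Convex ℝ P)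
    (hcone : ∀ x ∈ P, ∀ t : ℝ, 0 ≤ t → t • x ∈ P)
    (hspan : ∀ v : E, ∃ x ∈ P, ∃ y ∈ P, v = x - y) (hA : A ≠ univ) (hA0 : (0 : E) ∈ A)
    (hmod : ∀ b ∈ A, ∀ p ∈ P, b + p ∈ A) :
    ∃ x ∈ P, ∃ r > 0, ∃ c : ℕ → E,
      (∀ k, ∀ z ∈ Metric.ball (c k) r, z ∈ A ∧ z - x ∉ A) ∧
      Pairwise fun j k => Disjoint (Metric.ball (c j) r) (Metric.ball (c k) r) := by
  obtain ⟨e, ρ, hρ, he⟩ := exists_ball_subset_of_spanning hconv hspan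
  obtain ⟨w, hw1, hwe⟩ : ∃ w : E, ‖w‖ = 1 ∧ inner ℝ w e = 0 := by
    have hne : (ℝ ∙ e)ᗮ ≠ ⊥ := by
      intro h
      have h1 := (ℝ ∙ e).finrank_add_finrank_orthogonal
      have h2 : Module.finrank ℝ (ℝ ∙ e) ≤ 1 := by
        simpa using finrank_span_le_card (R := ℝ) ({e} : Set E)
      rw [h, finrank_bot] at h1
      omega
    obtain ⟨w, hw, hw0⟩ := Submodule.exists_mem_ne_zero_of_ne_bot hne
    refine ⟨‖w‖⁻¹ • w, norm_smul_inv_norm hw0, ?_⟩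
    rw [inner_smul_left, Submodule.mem_orthogonal_singleton_iff_inner_left.mp hw, mul_zero]
  choose t ht ht' using fun k : ℕ =>
    exists_mem_and_sub_half_notMem hcone hA hA0 hmod hρ he ((k : ℝ) • w)
  refine ⟨(2 : ℝ) • e, hcone e (he (Metric.mem_ball_self hρ)) 2 (by norm_num),
    min (ρ / 2) (1 / 2), by positivity, fun k => ((k : ℝ) • w + t k • e) + e, ?_, ?_⟩
  · intro k z hz
    have hzρ : ‖z - (((k : ℝ) • w + t k • e) + e)‖ < ρ / 2 := by
      rw [← dist_eq_norm]
      exact (Metric.mem_ball.mp hz).trans_le (min_le_left _ _)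
    obtain ⟨u, rfl⟩ : ∃ u, z = (((k : ℝ) • w + t k • e) + e) + u := ⟨_, (add_sub_cancel _ z).symm⟩
    rw [add_sub_cancel_left] at hzρ
    constructor
    · rw [add_assoc]
      refine hmod _ (ht k) _ (he ?_)
      rw [Metric.mem_ball, dist_eq_norm, add_sub_cancel_left]
      linarith
    · intro h
      have hmem : e - (2 : ℝ) • u ∈ P := by
        apply he
        rw [Metric.mem_ball, dist_eq_norm, sub_sub_cancel_left, norm_neg, norm_smul]
        norm_num
        linarith
      refine ht' k ?_
      convert hmod _ h _ (hcone _ hmem (1 / 2) (by norm_num)) using 1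
      module
  · intro j k hjk
    apply Metric.ball_disjoint_ball
    have hjk' : (1 : ℝ) ≤ |(j : ℝ) - k| := by
      have : (1 : ℤ) ≤ |(j : ℤ) - k| := Int.one_le_abs (sub_ne_zero.mpr (by exact_mod_cast hjk))
      exact_mod_cast this
    have hinner : inner ℝ w (((j : ℝ) • w + t j • e + e) - ((k : ℝ) • w + t k • e + e))
        = (j : ℝ) - k := by
      simp only [inner_sub_right, inner_add_right, inner_smul_right, hwe,
        real_inner_self_eq_norm_sq, hw1]
      ring
    have hle := abs_real_inner_le_norm w
      (((j : ℝ) • w + t j • e + e) - ((k : ℝ) • w + t k • e + e))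
    rw [hinner, hw1, one_mul, ← dist_eq_norm] at hle
    have := min_le_right (ρ / 2) (1 / 2)
    linarith

end Cone

section Density

variable {E : Type*} [NormedAddCommGroup E] [MeasurableSpace E] [BorelSpace E]
  {μ : Measure E} [μ.IsAddRightInvariant]

/-- A family of densities transforming like the squared pointwise norm of an additive cocycle
vanishes almost everywhere, as soon as one of the sets `A \ (A + x₀)` contains infinitely many
disjoint balls of equal radius. -/
lemma ae_eq_zero_of_translation_covariant [SecondCountableTopology E] {P A : Set E}
    (hA : MeasurableSet A)
    (hspan : ∀ v : E, ∃ x ∈ P, ∃ y ∈ P, v = x - y)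
    (hPadd : ∀ x ∈ P, ∀ y ∈ P, x + y ∈ P)
    (F : E → E → ℝ≥0∞) (hmeas : ∀ x ∈ P, AEMeasurable (F x) μ)
    (hoff : ∀ x, ∀ z ∉ A, F x z = 0)
    (hmono : ∀ x ∈ P, ∀ y ∈ P, ∀ᵐ z ∂μ, F x z ≤ F (x + y) z)
    (hloc : ∀ x ∈ P, ∀ y ∈ P, ∀ᵐ z ∂μ, z - x ∉ A → F (x + y) z = F x z)
    (htrans : ∀ x ∈ P, ∀ y ∈ P, ∀ᵐ z ∂μ, z - x ∈ A → F (x + y) z = F y (z - x))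
    {x₀ : E} (hx₀ : x₀ ∈ P) (hfin : ∫⁻ z, F x₀ z ∂μ ≠ ∞) {r : ℝ} (hr : 0 < r) {c : ℕ → E}
    (hc : ∀ k, ∀ z ∈ Metric.ball (c k) r, z ∈ A ∧ z - x₀ ∉ A)
    (hdisj : Pairwise fun j k => Disjoint (Metric.ball (c j) r) (Metric.ball (c k) r)) :
    ∀ x ∈ P, F x =ᵐ[μ] 0 := by
  set N : E → Set E → ℝ≥0∞ := fun x S => ∫⁻ z, S.indicator (F x) z ∂μ with hN
  have N_mono : ∀ x ∈ P, ∀ y ∈ P, ∀ S, N x S ≤ N (x + y) S := by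
    intro x hx y hy S
    refine lintegral_mono_ae ?_
    filter_upwards [hmono x hx y hy] with z hz
    by_cases h : z ∈ S <;> simp [h, hz]
  have N_subset : ∀ x, ∀ S T : Set E, S ⊆ T → N x S ≤ N x T := fun x S T h =>
    lintegral_mono (indicator_le_indicator_of_subset h fun _ => zero_le)
  have N_trans : ∀ x ∈ P, ∀ y ∈ P, ∀ S ⊆ A, N (x + y) ((fun z => z - x) ⁻¹' S) = N y S := by
    intro x hx y hy S hS
    rw [hN]
    dsimp only
    rw [← lintegral_sub_right_eq_self (fun z => S.indicator (F y) z) x]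
    refine lintegral_congr_ae ?_
    filter_upwards [htrans x hx y hy] with z hz
    by_cases h : z - x ∈ S
    · simp [h, hz (hS h)]
    · simp [h]
  set M : Set E → ℝ≥0∞ := fun S => ⨆ x ∈ P, N x S
  have N_le_M : ∀ x ∈ P, ∀ S, N x S ≤ M S := fun x hx S =>
    le_iSup₂ (f := fun x (_ : x ∈ P) => N x S) x hx
  have M_trans : ∀ p ∈ P, ∀ S ⊆ A, M ((fun z => z - p) ⁻¹' S) = M S := by
    intro p hp S hS
    apply le_antisymm
    · refine iSup₂_le fun x hx => ?_
      calc N x ((fun z => z - p) ⁻¹' S) ≤ N (x + p) ((fun z => z - p) ⁻¹' S) :=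
            N_mono x hx p hp _
        _ = N x S := by rw [add_comm, N_trans p hp x hx S hS]
        _ ≤ M S := N_le_M x hx S
    · refine iSup₂_le fun x hx => ?_
      rw [← N_trans p hp x hx S hS]
      exact N_le_M _ (hPadd p hp x hx) _
  have M_le_of_subset_translate : ∀ a b : E, Metric.ball b r ⊆ A →
      M (A ∩ Metric.ball a r) ≤ M (Metric.ball b r) := by
    intro a b hb
    obtain ⟨p, hp, q, hq, hpq⟩ := hspan (b - a)
    rw [← M_trans p hp _ inter_subset_left, ← M_trans q hq _ hb]
    refine iSup₂_mono fun x _ => N_subset x _ _ fun z hz => ?_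
    have h := hz.2
    rw [Metric.mem_ball, dist_eq_norm] at h
    rw [mem_preimage, Metric.mem_ball, dist_eq_norm]
    convert h using 2
    rw [sub_sub, sub_sub, add_comm q, add_comm p, sub_eq_sub_iff_add_eq_add.mp hpq, add_comm]
  have ball_sub : ∀ k, Metric.ball (c k) r ⊆ A := fun k z hz => (hc k z hz).1
  have M_ball : ∀ k, M (Metric.ball (c k) r) = N x₀ (Metric.ball (c k) r) := by
    intro k
    apply le_antisymm _ (N_le_M x₀ hx₀ _)
    refine iSup₂_le fun x hx => ?_
    calc N x (Metric.ball (c k) r) ≤ N (x + x₀) (Metric.ball (c k) r) := N_mono x hx x₀ hx₀ _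
      _ = N x₀ (Metric.ball (c k) r) := by
        rw [add_comm]
        refine lintegral_congr_ae ?_
        filter_upwards [hloc x₀ hx₀ x hx] with z hz
        by_cases h : z ∈ Metric.ball (c k) r
        · simp only [indicator_of_mem h, hz (hc k z h).2]
        · simp only [indicator_of_notMem h]
  have M_const : ∀ k, M (Metric.ball (c 0) r) ≤ N x₀ (Metric.ball (c k) r) := by
    intro k
    have h := M_le_of_subset_translate (c 0) (c k) (ball_sub k)
    rwa [inter_eq_right.mpr (ball_sub 0), M_ball k] at h
  have M_zero : M (Metric.ball (c 0) r) = 0 := by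
    by_contra hne
    apply hfin
    rw [eq_top_iff]
    calc ∞ = ∑' _ : ℕ, M (Metric.ball (c 0) r) := (ENNReal.tsum_const_eq_top_of_ne_zero hne).symm
      _ ≤ ∑' k, N x₀ (Metric.ball (c k) r) := ENNReal.tsum_le_tsum M_const
      _ = ∑' k, ∫⁻ z in Metric.ball (c k) r, F x₀ z ∂μ := by
        simp only [hN, lintegral_indicator measurableSet_ball]
      _ = ∫⁻ z in ⋃ k, Metric.ball (c k) r, F x₀ z ∂μ :=
        (lintegral_iUnion (fun _ => measurableSet_ball) hdisj _).symm
      _ ≤ ∫⁻ z, F x₀ z ∂μ := setLIntegral_le_lintegral _ _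
  intro x hx
  have hnull : μ {z | F x z ≠ 0} = 0 := by
    refine measure_null_of_locally_null _ fun a _ => ?_
    refine ⟨{z | F x z ≠ 0} ∩ Metric.ball a r,
      inter_mem self_mem_nhdsWithin (mem_nhdsWithin_of_mem_nhds (Metric.ball_mem_nhds a hr)), ?_⟩
    have hz : N x (A ∩ Metric.ball a r) = 0 := by
      apply le_antisymm _ zero_le
      rw [← M_zero]
      exact (N_le_M x hx _).trans (M_le_of_subset_translate a (c 0) (ball_sub 0))
    have hms : MeasurableSet (A ∩ Metric.ball a r) := hA.inter measurableSet_ball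
    have hae := (lintegral_eq_zero_iff' ((hmeas x hx).indicator hms)).mp hz
    refine measure_mono_null (fun z hzs => ?_) (ae_iff.mp hae)
    have hzA : z ∈ A := by
      by_contra h
      exact hzs.1 (hoff x z h)
    rw [mem_ofPred_eq, indicator_of_mem (mem_inter hzA hzs.2)]
    exact hzs.1
  exact ae_iff.mpr hnull

end Density

section Shift

variable {E : Type*} [NormedAddCommGroup E] [MeasurableSpace E] [BorelSpace E]
  {μ : Measure E} [μ.IsAddRightInvariant] {K : Type*} [NormedAddCommGroup K]
  [InnerProductSpace ℂ K]

/-- An element of the kernel of the adjoint of the shift by `x` vanishes on `A + x`. -/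
lemma ae_eq_zero_of_adjoint_shift_eq_zero [CompleteSpace K] {A : Set E} (hA : MeasurableSet A)
    {x : E} (hx : ∀ b ∈ A, b + x ∈ A)
    (V : Lp K 2 (μ.restrict A) →L[ℂ] Lp K 2 (μ.restrict A))
    (hV : ∀ f : Lp K 2 (μ.restrict A),
      ⇑(V f) =ᵐ[μ.restrict A] fun y => A.indicator (⇑f) (y - x))
    {f : Lp K 2 (μ.restrict A)} (hf : ContinuousLinearMap.adjoint V f = 0) :
    ∀ᵐ z ∂μ.restrict A, z - x ∈ A → f z = 0 := by
  have hmp : MeasurePreserving (fun y => y + x) (μ.restrict A)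
      (μ.restrict ((fun z => z - x) ⁻¹' A)) := by
    have h := (measurePreserving_add_right μ x).restrict_preimage
      (s := (fun z => z - x) ⁻¹' A) (hA.preimage (measurable_sub_const x))
    simpa [preimage_preimage] using h
  have hsub : (fun z => z - x) ⁻¹' A ⊆ A := fun z hz => by simpa using hx _ hz
  have hmem : MemLp (fun y => f (y + x)) 2 (μ.restrict A) :=
    ((Lp.memLp f).mono_measure (Measure.restrict_mono hsub le_rfl)).comp_measurePreserving hmp
  set g : Lp K 2 (μ.restrict A) := hmem.toLp _
  have hg' : ∀ᵐ z ∂μ, z - x ∈ A → g (z - x) = f z := by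
    have h := (ae_restrict_iff' hA).mp hmem.coeFn_toLp
    have h' := (measurePreserving_sub_right μ x).quasiMeasurePreserving.ae h
    filter_upwards [h'] with z hz hzA
    simpa using hz hzA
  have hVg : ∀ᵐ z ∂μ.restrict A, V g z = ((fun z => z - x) ⁻¹' A).indicator f z := by
    filter_upwards [hV g, ae_restrict_of_ae hg'] with z hz hz'
    rw [hz]
    by_cases h : z - x ∈ A
    · rw [indicator_of_mem h, hz' h, indicator_of_mem (by exact h)]
    · rw [indicator_of_notMem h, indicator_of_notMem (by exact h)]
  have hinner : inner ℂ (V g) (V g) = inner ℂ (V g) f := by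
    rw [L2.inner_def, L2.inner_def]
    refine integral_congr_ae ?_
    filter_upwards [hVg] with z hz
    by_cases h : z ∈ (fun z => z - x) ⁻¹' A <;> simp [hz, h]
  rw [← ContinuousLinearMap.adjoint_inner_right V g f, hf, inner_zero_right, inner_self_eq_zero]
    at hinner
  have hzero : ⇑(V g) =ᵐ[μ.restrict A] 0 := by
    rw [hinner]
    exact Lp.coeFn_zero _ _ _
  filter_upwards [hVg, hzero] with z hz hz0 hzA
  rw [hz0, indicator_of_mem (by exact hzA)] at hz
  exact hz.symm

end Shift

/-- For `d ≥ 2`, a `P`-module `A` and a separable Hilbert space `K`, the isometric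
representation `V` of `P` on `L²(A; K)` (given by `(V_x f)(y) = f (y - x)` if
`y - x ∈ A` and `0` otherwise) admits no nonzero additive cocycle. -/
theorem no_additive_cocycle_multiplicity_k
    (d : ℕ) (hd : 2 ≤ d) (P A : Set (EuclideanSpace ℝ (Fin d)))
    (hPclosed : IsClosed P) (hPconvex : Convex ℝ P)
    (hPcone : ∀ x ∈ P, ∀ t : ℝ, 0 ≤ t → t • x ∈ P)
    (hPspan : ∀ v : EuclideanSpace ℝ (Fin d), ∃ x ∈ P, ∃ y ∈ P, v = x - y)
    (hPpointed : P ∩ (-P) = {0})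
    (hAclosed : IsClosed A) (hAproper : A ≠ Set.univ)
    (hAzero : (0 : EuclideanSpace ℝ (Fin d)) ∈ A)
    (hAmod : ∀ b ∈ A, ∀ p ∈ P, b + p ∈ A)
    (K : Type*) [NormedAddCommGroup K] [InnerProductSpace ℂ K] [CompleteSpace K]
    [TopologicalSpace.SeparableSpace K]
    (V : EuclideanSpace ℝ (Fin d) →
      (Lp K 2 (volume.restrict A) →L[ℂ] Lp K 2 (volume.restrict A)))
    (hV : ∀ x ∈ P, ∀ f : Lp K 2 (volume.restrict A),
      ⇑(V x f) =ᵐ[volume.restrict A] fun y => A.indicator (⇑f) (y - x))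
    (ξ : EuclideanSpace ℝ (Fin d) → Lp K 2 (volume.restrict A))
    (hadd : ∀ x ∈ P, ∀ y ∈ P, ξ (x + y) = ξ x + V x (ξ y))
    (horth : ∀ x ∈ P, ContinuousLinearMap.adjoint (V x) (ξ x) = 0)
    (hcont : ContinuousOn ξ P) :
    ∀ x ∈ P, ξ x = 0 := by
  have hPadd : ∀ x ∈ P, ∀ y ∈ P, x + y ∈ P := fun x hx y hy =>
    add_mem_of_convex_cone hPconvex hPcone hx hy
  have hA : MeasurableSet A := hAclosed.measurableSet
  obtain ⟨x₀, hx₀, r, hr, c, hc, hdisj⟩ := exists_disjoint_balls (by simpa using hd) hPconvex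
    hPcone hPspan hAproper hAzero hAmod
  have hker : ∀ x ∈ P, ∀ᵐ z ∂volume, z ∈ A → z - x ∈ A → ξ x z = 0 := fun x hx =>
    (ae_restrict_iff' hA).mp (ae_eq_zero_of_adjoint_shift_eq_zero hA
      (fun b hb => hAmod b hb x hx) (V x) (hV x hx) (horth x hx))
  have hcoc : ∀ x ∈ P, ∀ y ∈ P, ∀ᵐ z ∂volume, z ∈ A →
      ξ (x + y) z = ξ x z + A.indicator (ξ y) (z - x) := by
    intro x hx y hy
    refine (ae_restrict_iff' hA).mp ?_
    rw [hadd x hx y hy]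
    filter_upwards [Lp.coeFn_add (ξ x) (V x (ξ y)), hV x hx (ξ y)] with z h1 h2
    rw [h1, Pi.add_apply, h2]
  obtain ⟨F, hF⟩ : ∃ F : EuclideanSpace ℝ (Fin d) → EuclideanSpace ℝ (Fin d) → ℝ≥0∞,
    F = fun x => A.indicator fun z => ‖ξ x z‖ₑ ^ (2 : ℝ) := ⟨_, rfl⟩
  have hmeas : ∀ x, AEMeasurable (F x) volume := fun x => by
    rw [hF]
    exact (aemeasurable_indicator_iff hA).mpr
      ((Lp.aestronglyMeasurable (ξ x)).enorm.pow_const 2)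
  have key : ∀ x ∈ P, F x =ᵐ[volume] 0 := by
    refine ae_eq_zero_of_translation_covariant hA hPspan hPadd F (fun x _ => hmeas x)
      (fun x z hz => by simp [hF, hz]) ?_ ?_ ?_ hx₀ ?_ hr hc hdisj
    · intro x hx y hy
      filter_upwards [hker x hx, hcoc x hx y hy] with z h1 h2
      by_cases hz : z ∈ A
      · simp only [hF, indicator_of_mem hz]
        by_cases hzx : z - x ∈ A
        · simp [h1 hz hzx]
        · simp [h2 hz, hzx]
      · simp [hF, hz]
    · intro x hx y hy
      filter_upwards [hcoc x hx y hy] with z h2 hzx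
      by_cases hz : z ∈ A
      · simp [hF, hz, h2 hz, hzx]
      · simp [hF, hz]
    · intro x hx y hy
      filter_upwards [hker x hx, hcoc x hx y hy] with z h1 h2 hzx
      have hz : z ∈ A := by simpa using hAmod _ hzx x hx
      simp [hF, hz, h2 hz, hzx, h1 hz hzx]
    · rw [hF, lintegral_indicator hA]
      have h := lintegral_rpow_enorm_lt_top_of_eLpNorm_lt_top two_ne_zero ENNReal.ofNat_ne_top
        (Lp.memLp (ξ x₀)).2
      simpa using h.ne
  intro x hx
  rw [Lp.eq_zero_iff_ae_eq_zero]
  refine (ae_restrict_iff' hA).mpr ?_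
  filter_upwards [key x hx] with z hz hzA
  simpa [hF, hzA] using hz
end

section
/- Let V be a strongly continuous isometric representation of P on a Hilbert space H, and suppose W : ℝ^d → B(H) is a map such that W_{x−y} = V_y* V_x for all x, y ∈ P and such that z ↦ W_z ξ is continuous for every ξ ∈ H. For f a continuous compactly supported function on ℝ^d, define the Wiener–Hopf operator W_f ∈ B(H) by W_f ξ = ∫_{ℝ^d} f(z) W_z ξ dz (Bochner integral). Then for every bounded operator T on H the following are equivalent: (i) T commutes with V_x and with V_x* for every x ∈ P; (ii) T commutes with W_f and with W_f* for every continuous compactly supported f on ℝ^d. Equivalently, the von Neumann algebra generated by {W_f : f ∈ C_c(ℝ^d)} coincides with the von Neumann algebra generated by {V_x : x ∈ P}. -/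
open MeasureTheory

/-- If `W` is a strongly continuous family of operators and `Wf f = ∫ f(z) W_z dz`, then a bounded
operator commutes with every `W_z` if and only if it commutes with every `Wf f`, `f ∈ C_c`. -/
theorem forall_commute_iff_forall_commute_integral {E H : Type*} [NormedAddCommGroup E]
    [NormedSpace ℝ E] [FiniteDimensional ℝ E] [MeasureSpace E] [BorelSpace E]
    [(volume : Measure E).IsOpenPosMeasure] [IsLocallyFiniteMeasure (volume : Measure E)]
    [NormedAddCommGroup H] [NormedSpace ℂ H] [CompleteSpace H]
    {W : E → (H →L[ℂ] H)} (hW : ∀ v : H, Continuous fun z => W z v)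
    {Wf : (E → ℂ) → (H →L[ℂ] H)}
    (hWf : ∀ f : E → ℂ, Continuous f → HasCompactSupport f → ∀ v : H, Wf f v = ∫ z, f z • W z v)
    (T : H →L[ℂ] H) :
    (∀ z, Commute T (W z)) ↔
      ∀ f : E → ℂ, Continuous f → HasCompactSupport f → Commute T (Wf f) := by
  have integrable_smul (f : E → ℂ) (hf : Continuous f) (hfc : HasCompactSupport f) (u : E → H)
      (hu : Continuous u) : Integrable fun z => f z • u z :=
    (hf.smul hu).integrable_of_hasCompactSupport hfc.smul_right
  have map_Wf (f : E → ℂ) (hf : Continuous f) (hfc : HasCompactSupport f) (v : H) :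
      T (Wf f v) = ∫ z, f z • T (W z v) := by
    rw [hWf f hf hfc, ← T.integral_comp_comm (integrable_smul f hf hfc _ (hW v))]
    simp only [map_smul]
  constructor
  · intro h f hf hfc
    ext v
    change T (Wf f v) = Wf f (T v)
    rw [map_Wf f hf hfc, hWf f hf hfc]
    congr 1 with z
    exact congrArg (f z • ·) (DFunLike.congr_fun (h z).eq v)
  · intro h z
    ext v
    have hcont₁ : Continuous fun z => T (W z v) := T.continuous.comp (hW v)
    have hcont : Continuous fun z => T (W z v) - W z (T v) := hcont₁.sub (hW (T v))
    have hae : ∀ᵐ z, T (W z v) - W z (T v) = 0 := by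
      refine ae_eq_zero_of_integral_contDiff_smul_eq_zero hcont.locallyIntegrable fun g hg hgc => ?_
      have hf : Continuous fun z => (g z : ℂ) := Complex.continuous_ofReal.comp hg.continuous
      have hfc : HasCompactSupport fun z => (g z : ℂ) := hgc.comp_left Complex.ofReal_zero
      have hcomm : T (Wf _ v) = Wf _ (T v) := DFunLike.congr_fun (h _ hf hfc).eq v
      rw [map_Wf _ hf hfc, hWf _ hf hfc, ← sub_eq_zero, ← integral_sub
        (integrable_smul _ hf hfc _ hcont₁) (integrable_smul _ hf hfc _ (hW (T v)))] at hcomm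
      simpa only [← smul_sub, Complex.coe_smul] using hcomm
    exact sub_eq_zero.mp (congrFun (Continuous.ae_eq_iff_eq volume hcont continuous_zero |>.mp hae) z)

/-- `T` commutes with `A†` if and only if `T†` commutes with `A`. -/
theorem commute_adjoint_iff {H : Type*} [NormedAddCommGroup H] [InnerProductSpace ℂ H]
    [CompleteSpace H] (T A : H →L[ℂ] H) :
    Commute T (ContinuousLinearMap.adjoint A) ↔ Commute (ContinuousLinearMap.adjoint T) A := by
  rw [← ContinuousLinearMap.star_eq_adjoint, ← ContinuousLinearMap.star_eq_adjoint,
    commute_star_comm]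

/-- Let `V` be a strongly continuous isometric representation of `P` on a Hilbert space
`H`, let `W_z` (`z ∈ ℝ^d`) be the associated strongly continuous family of partial
isometries with `W_{x-y} = V_y^* V_x` for `x, y ∈ P`, and for `f ∈ C_c(ℝ^d)` let
`W_f = ∫ f(z) W_z dz` be the Wiener–Hopf operator with symbol `f`. Then a bounded
operator `T` commutes with all `V_x, V_x^*` (`x ∈ P`) iff it commutes with all
`W_f, W_f^*` (`f ∈ C_c(ℝ^d)`); i.e. the von Neumann algebras generated by
`{W_f : f ∈ C_c(ℝ^d)}` and by `{V_x : x ∈ P}` coincide. -/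
theorem wienerHopf_generates_same_vonNeumann
    (d : ℕ) (P : Set (EuclideanSpace ℝ (Fin d)))
    (hPclosed : IsClosed P) (hPconvex : Convex ℝ P)
    (hPcone : ∀ x ∈ P, ∀ t : ℝ, 0 ≤ t → t • x ∈ P)
    (hPspan : ∀ v : EuclideanSpace ℝ (Fin d), ∃ x ∈ P, ∃ y ∈ P, v = x - y)
    (hPpointed : P ∩ (-P) = {0})
    (H : Type*) [NormedAddCommGroup H] [InnerProductSpace ℂ H] [CompleteSpace H]
    (V : EuclideanSpace ℝ (Fin d) → (H →L[ℂ] H))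
    (hV_isom : ∀ x ∈ P, ∀ v : H, ‖V x v‖ = ‖v‖)
    (hV_mul : ∀ x ∈ P, ∀ y ∈ P, (V x).comp (V y) = V (x + y))
    (hV_cont : ∀ v : H, ContinuousOn (fun x => V x v) P)
    (W : EuclideanSpace ℝ (Fin d) → (H →L[ℂ] H))
    (hW : ∀ x ∈ P, ∀ y ∈ P, W (x - y) = (ContinuousLinearMap.adjoint (V y)).comp (V x))
    (hW_cont : ∀ v : H, Continuous fun z => W z v)
    (Wf : (EuclideanSpace ℝ (Fin d) → ℂ) → (H →L[ℂ] H))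
    (hWf : ∀ f : EuclideanSpace ℝ (Fin d) → ℂ, Continuous f → HasCompactSupport f →
      ∀ v : H, Wf f v = ∫ z, f z • W z v) :
    ∀ T : H →L[ℂ] H,
      (∀ x ∈ P, Commute T (V x) ∧ Commute T (ContinuousLinearMap.adjoint (V x))) ↔
      (∀ f : EuclideanSpace ℝ (Fin d) → ℂ, Continuous f → HasCompactSupport f →
        Commute T (Wf f) ∧ Commute T (ContinuousLinearMap.adjoint (Wf f))) := by
  obtain ⟨p, hp, -⟩ := hPspan 0
  have hzero : (0 : EuclideanSpace ℝ (Fin d)) ∈ P := by simpa using hPcone p hp 0 le_rfl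
  have hV_zero : V 0 = 1 := by
    ext v
    have hmul : V 0 (V 0 v) = V 0 v := by
      simpa using DFunLike.congr_fun (hV_mul 0 hzero 0 hzero) v
    have hnorm := hV_isom 0 hzero (V 0 v - v)
    rw [map_sub, hmul, sub_self, norm_zero] at hnorm
    exact sub_eq_zero.mp (norm_eq_zero.mp hnorm.symm)
  have hW_eq_V (x) (hx : x ∈ P) : W x = V x := by
    have h := hW x hx 0 hzero
    rwa [sub_zero, hV_zero, ← ContinuousLinearMap.star_eq_adjoint, star_one,
      ContinuousLinearMap.one_def, ContinuousLinearMap.id_comp] at h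
  have commute_W (S : H →L[ℂ] H)
      (hS : ∀ x ∈ P, Commute S (V x) ∧ Commute S (ContinuousLinearMap.adjoint (V x))) (z) :
      Commute S (W z) := by
    obtain ⟨x, hx, y, hy, rfl⟩ := hPspan z
    rw [hW x hx y hy]
    exact (hS y hy).2.mul_right (hS x hx).1
  intro T
  have key := forall_commute_iff_forall_commute_integral hW_cont hWf
  constructor
  · intro h f hf hfc
    refine ⟨(key T).mp (commute_W T h) f hf hfc, (commute_adjoint_iff _ _).mpr ?_⟩
    refine (key _).mp (commute_W _ fun x hx => ⟨(commute_adjoint_iff _ _).mp (h x hx).2, ?_⟩) f hf hfc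
    rw [commute_adjoint_iff, ContinuousLinearMap.adjoint_adjoint]
    exact (h x hx).1
  · intro h x hx
    rw [commute_adjoint_iff, ← hW_eq_V x hx]
    exact ⟨(key T).mpr (fun f hf hfc => (h f hf hfc).1) x,
      (key _).mpr (fun f hf hfc => (commute_adjoint_iff _ _).mp (h f hf hfc).2) x⟩
end

section
/- Assume d ≥ 2, let A be a P-module in ℝ^d, and let V = {V_x}_{x∈P} be the isometric representation of P on L²(A) associated to A of multiplicity 1. Then the commutant of the set {V_x : x ∈ P} ∪ {V_x* : x ∈ P} in B(L²(A)) equals the double commutant {U_z : z ∈ G_A}′′; that is, the commutant of the von Neumann algebra generated by {V_x : x ∈ P} is the von Neumann algebra generated by the unitaries {U_z : z ∈ G_A}. -/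
open MeasureTheory Filter Topology
open scoped ENNReal BoundedContinuousFunction ComplexConjugate InnerProductSpace FourierTransform
  Convolution

/-- A signed density whose integrals against a point-separating star algebra of functions factoring
through `π` vanish integrates to zero against every bounded measurable function of `π`. -/
theorem integral_comp_mul_ofReal_eq_zero_of_separatesPoints {α X : Type*} [MeasurableSpace α]
    {μ : Measure α} [PseudoEMetricSpace X] [CompleteSpace X] [SecondCountableTopology X]
    [MeasurableSpace X] [BorelSpace X] {π : α → X} (hπ : Measurable π)
    {𝒜 : StarSubalgebra ℂ (X →ᵇ ℂ)}
    (h𝒜 : (𝒜.map (BoundedContinuousFunction.toContinuousMapStarₐ ℂ)).SeparatesPoints)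
    {k : α → ℝ} (hk : Integrable k μ)
    (hzero : ∀ a ∈ 𝒜, ∫ x, a (π x) * (k x : ℂ) ∂μ = 0)
    {u : X → ℂ} (hu : Measurable u) {C : ℝ} (hC : ∀ x, ‖u x‖ ≤ C) :
    ∫ x, u (π x) * (k x : ℂ) ∂μ = 0 := by
  have key : ∀ (s : α → ℝ), Integrable s μ → (∀ x, 0 ≤ s x) → ∀ v : X → ℂ, Measurable v →
      ∫ x, v x ∂((μ.withDensity fun x => ENNReal.ofReal (s x)).map π) =
        ∫ x, v (π x) * (s x : ℂ) ∂μ := by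
    intro s hs hs0 v hv
    rw [integral_map hπ.aemeasurable hv.aestronglyMeasurable,
      integral_withDensity_eq_integral_toReal_smul₀ hs.aemeasurable.ennreal_ofReal
        (Filter.Eventually.of_forall fun _ => ENNReal.ofReal_lt_top)]
    refine integral_congr_ae (Filter.Eventually.of_forall fun x => ?_)
    simp [ENNReal.toReal_ofReal (hs0 x), mul_comm]
  have hp : Integrable (fun x => max (k x) 0) μ := hk.pos_part
  have hn : Integrable (fun x => max (-k x) 0) μ := hk.neg_part
  have hfin : ∀ s : α → ℝ, Integrable s μ →
      IsFiniteMeasure ((μ.withDensity fun x => ENNReal.ofReal (s x)).map π) := by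
    intro s hs
    have := isFiniteMeasure_withDensity_ofReal hs.2
    infer_instance
  have := hfin _ hp
  have := hfin _ hn
  have hsub : ∀ v : X → ℂ, Measurable v → ∀ C : ℝ, (∀ x, ‖v x‖ ≤ C) →
      ∫ x, v (π x) * (k x : ℂ) ∂μ = ∫ x, v (π x) * ((max (k x) 0 : ℝ) : ℂ) ∂μ -
        ∫ x, v (π x) * ((max (-k x) 0 : ℝ) : ℂ) ∂μ := by
    intro v hv C hC
    rw [← integral_sub]
    · refine integral_congr_ae (Filter.Eventually.of_forall fun x => ?_)
      simp only
      rw [← mul_sub, ← Complex.ofReal_sub]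
      congr 2
      rcases le_total 0 (k x) with h | h <;> simp [h]
    · exact hp.ofReal.bdd_mul (hv.comp hπ).aestronglyMeasurable
        (Filter.Eventually.of_forall fun _ => hC _)
    · exact hn.ofReal.bdd_mul (hv.comp hπ).aestronglyMeasurable
        (Filter.Eventually.of_forall fun _ => hC _)
  have heq := ext_of_forall_mem_subalgebra_integral_eq_of_pseudoEMetric_complete_countable
    (P := (μ.withDensity fun x => ENNReal.ofReal (max (k x) 0)).map π)
    (P' := (μ.withDensity fun x => ENNReal.ofReal (max (-k x) 0)).map π) h𝒜 (by
      intro a ha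
      rw [key _ hp (fun _ => le_max_right _ _) _ a.continuous.measurable,
        key _ hn (fun _ => le_max_right _ _) _ a.continuous.measurable, ← sub_eq_zero,
        ← hsub a a.continuous.measurable ‖a‖ a.norm_coe_le_norm]
      exact hzero a ha)
  rw [hsub u hu C hC, ← key _ hp (fun _ => le_max_right _ _) _ hu,
    ← key _ hn (fun _ => le_max_right _ _) _ hu, heq, sub_self]

/-- Complex version of `integral_comp_mul_ofReal_eq_zero_of_separatesPoints`. -/
theorem integral_comp_mul_eq_zero_of_separatesPoints {α X : Type*} [MeasurableSpace α]
    {μ : Measure α} [PseudoEMetricSpace X] [CompleteSpace X] [SecondCountableTopology X]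
    [MeasurableSpace X] [BorelSpace X] {π : α → X} (hπ : Measurable π)
    {𝒜 : StarSubalgebra ℂ (X →ᵇ ℂ)}
    (h𝒜 : (𝒜.map (BoundedContinuousFunction.toContinuousMapStarₐ ℂ)).SeparatesPoints)
    {k : α → ℂ} (hk : Integrable k μ)
    (hzero : ∀ a ∈ 𝒜, ∫ x, a (π x) * k x ∂μ = 0)
    {u : X → ℂ} (hu : Measurable u) {C : ℝ} (hC : ∀ x, ‖u x‖ ≤ C) :
    ∫ x, u (π x) * k x ∂μ = 0 := by
  have h_int : ∀ v : X → ℂ, Measurable v → ∀ C : ℝ, (∀ x, ‖v x‖ ≤ C) →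
      ∀ s : α → ℂ, Integrable s μ → Integrable (fun x => v (π x) * s x) μ := by
    intro v hv C hC s hs
    exact hs.bdd_mul (hv.comp hπ).aestronglyMeasurable (Filter.Eventually.of_forall fun _ => hC _)
  have hconj : ∀ a ∈ 𝒜, ∫ x, a (π x) * conj (k x) ∂μ = 0 := by
    intro a ha
    have h := hzero (star a) (star_mem ha)
    have h2 : ∫ x, conj ((star a) (π x) * k x) ∂μ = 0 := by rw [integral_conj, h, map_zero]
    rw [← h2]
    refine integral_congr_ae (Filter.Eventually.of_forall fun x => ?_)
    simp
  have hkc : Integrable (fun x => conj (k x)) μ := by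
    exact (Complex.conjLIE.integrable_comp_iff).2 hk
  have hre : ∫ x, u (π x) * ((k x).re : ℂ) ∂μ = 0 := by
    refine integral_comp_mul_ofReal_eq_zero_of_separatesPoints hπ h𝒜 hk.re (fun a ha => ?_) hu hC
    have e : ∀ x, a (π x) * ((RCLike.re (k x) : ℝ) : ℂ) =
        (1 / 2) * (a (π x) * k x) + (1 / 2) * (a (π x) * conj (k x)) := by
      intro x
      rw [RCLike.re_eq_complex_re, Complex.re_eq_add_conj]; ring
    simp_rw [e]
    have i1 := h_int a a.continuous.measurable ‖a‖ a.norm_coe_le_norm _ hk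
    have i2 := h_int a a.continuous.measurable ‖a‖ a.norm_coe_le_norm _ hkc
    rw [integral_add (i1.const_mul _) (i2.const_mul _), integral_const_mul, integral_const_mul,
      hzero a ha, hconj a ha]
    simp
  have him : ∫ x, u (π x) * ((k x).im : ℂ) ∂μ = 0 := by
    refine integral_comp_mul_ofReal_eq_zero_of_separatesPoints hπ h𝒜 hk.im (fun a ha => ?_) hu hC
    have e : ∀ x, a (π x) * ((RCLike.im (k x) : ℝ) : ℂ) =
        (1 / (2 * Complex.I)) * (a (π x) * k x) -
          (1 / (2 * Complex.I)) * (a (π x) * conj (k x)) := by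
      intro x
      rw [RCLike.im_eq_complex_im, Complex.im_eq_sub_conj]; ring
    simp_rw [e]
    have i1 := h_int a a.continuous.measurable ‖a‖ a.norm_coe_le_norm _ hk
    have i2 := h_int a a.continuous.measurable ‖a‖ a.norm_coe_le_norm _ hkc
    rw [integral_sub (i1.const_mul _) (i2.const_mul _), integral_const_mul, integral_const_mul,
      hzero a ha, hconj a ha]
    simp
  have e : ∀ x, u (π x) * k x =
      u (π x) * ((k x).re : ℂ) + Complex.I * (u (π x) * ((k x).im : ℂ)) := by
    intro x
    conv_lhs => rw [← Complex.re_add_im (k x)]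
    ring
  simp_rw [e]
  have i1 : Integrable (fun x => u (π x) * ((k x).re : ℂ)) μ := h_int u hu C hC _ hk.re.ofReal
  have i2 : Integrable (fun x => u (π x) * ((k x).im : ℂ)) μ := h_int u hu C hC _ hk.im.ofReal
  rw [integral_add i1 (i2.const_mul _), integral_const_mul, hre, him]
  simp

theorem norm_indicator_one_le {α : Type*} (S : Set α) (x : α) :
    ‖S.indicator (fun _ => (1 : ℂ)) x‖ ≤ 1 :=
  (norm_indicator_le_norm_self _ x).trans norm_one.le

section Multiplication

variable {α : Type*} [MeasurableSpace α] {μ : Measure α}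

/-- Multiplication by an essentially bounded function, as an operator on `L²`. -/
noncomputable def mulOperator {u : α → ℂ} (hu : MemLp u ∞ μ) : Lp ℂ 2 μ →L[ℂ] Lp ℂ 2 μ :=
  (ContinuousLinearMap.mul ℂ ℂ).holderL μ ∞ 2 2 (hu.toLp u)

theorem coeFn_mulOperator {u : α → ℂ} (hu : MemLp u ∞ μ) (f : Lp ℂ 2 μ) :
    mulOperator hu f =ᵐ[μ] fun x => u x * f x := by
  have h := (ContinuousLinearMap.mul ℂ ℂ).coeFn_holder (r := 2) (hu.toLp u) f
  filter_upwards [h, hu.coeFn_toLp] with x hx hx'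
  rw [← hx']
  exact hx

theorem mulOperator_comp {u v : α → ℂ} (hu : MemLp u ∞ μ) (hv : MemLp v ∞ μ)
    (huv : MemLp (fun x => u x * v x) ∞ μ) :
    mulOperator huv = mulOperator hu * mulOperator hv := by
  ext f
  filter_upwards [coeFn_mulOperator huv f, coeFn_mulOperator hu (mulOperator hv f),
    coeFn_mulOperator hv f] with x h1 h2 h3
  rw [h1, mul_apply_eq_comp, h2, h3, mul_assoc]

theorem mulOperator_add {u v : α → ℂ} (hu : MemLp u ∞ μ) (hv : MemLp v ∞ μ)
    (huv : MemLp (fun x => u x + v x) ∞ μ) :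
    mulOperator huv = mulOperator hu + mulOperator hv := by
  ext f
  filter_upwards [coeFn_mulOperator huv f, coeFn_mulOperator hu f,
    coeFn_mulOperator hv f, Lp.coeFn_add (mulOperator hu f) (mulOperator hv f)] with x h1 h2 h3 h4
  rw [h1, add_apply, h4, Pi.add_apply, h2, h3, add_mul]

theorem mulOperator_const (c : ℂ) (hc : MemLp (fun _ : α => c) ∞ μ) :
    mulOperator hc = c • 1 := by
  ext f
  filter_upwards [coeFn_mulOperator hc f, Lp.coeFn_smul c f] with x h1 h2
  rw [h1, smul_apply, one_apply_eq_self, h2]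
  rfl

/-- The density of the commutator of `T` with multiplication operators, at the vectors `f`, `g`. -/
noncomputable def commutatorDensity (T : Lp ℂ 2 μ →L[ℂ] Lp ℂ 2 μ) (f g : Lp ℂ 2 μ) : α → ℂ :=
  fun x => conj (ContinuousLinearMap.adjoint T g x) * f x - conj (g x) * T f x

theorem integrable_conj_mul (f g : Lp ℂ 2 μ) : Integrable (fun x => conj (g x) * f x) μ := by
  simpa [mul_comm] using L2.integrable_inner (𝕜 := ℂ) g f

theorem integrable_commutatorDensity (T : Lp ℂ 2 μ →L[ℂ] Lp ℂ 2 μ) (f g : Lp ℂ 2 μ) :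
    Integrable (commutatorDensity T f g) μ :=
  (integrable_conj_mul _ _).sub (integrable_conj_mul _ _)

theorem inner_mulOperator {u : α → ℂ} (hu : MemLp u ∞ μ) (f g : Lp ℂ 2 μ) :
    ⟪g, mulOperator hu f⟫_ℂ = ∫ x, u x * (conj (g x) * f x) ∂μ := by
  rw [L2.inner_def]
  refine integral_congr_ae ?_
  filter_upwards [coeFn_mulOperator hu f] with x hx
  simp only [RCLike.inner_apply, hx]
  ring

theorem integrable_mul_of_memLp_top {u k : α → ℂ} (hu : MemLp u ∞ μ) (hk : Integrable k μ) :
    Integrable (fun x => u x * k x) μ := by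
  rw [← memLp_one_iff_integrable] at hk ⊢
  exact hk.mul hu

theorem inner_commutator_eq_integral (T : Lp ℂ 2 μ →L[ℂ] Lp ℂ 2 μ) {u : α → ℂ} (hu : MemLp u ∞ μ)
    (f g : Lp ℂ 2 μ) :
    ⟪g, T (mulOperator hu f)⟫_ℂ - ⟪g, mulOperator hu (T f)⟫_ℂ =
      ∫ x, u x * commutatorDensity T f g x ∂μ := by
  rw [← ContinuousLinearMap.adjoint_inner_left, inner_mulOperator, inner_mulOperator,
    ← integral_sub (integrable_mul_of_memLp_top hu (integrable_conj_mul _ _))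
      (integrable_mul_of_memLp_top hu (integrable_conj_mul _ _))]
  simp only [commutatorDensity, mul_sub]

theorem commute_mulOperator_iff (T : Lp ℂ 2 μ →L[ℂ] Lp ℂ 2 μ) {u : α → ℂ} (hu : MemLp u ∞ μ) :
    Commute T (mulOperator hu) ↔ ∀ f g, ∫ x, u x * commutatorDensity T f g x ∂μ = 0 := by
  simp only [← inner_commutator_eq_integral T hu, sub_eq_zero]
  constructor
  · intro h f g
    rw [← mul_apply_eq_comp, h.eq, mul_apply_eq_comp]
  · intro h
    ext1 f
    exact ext_inner_left ℂ fun g => h f g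

theorem memLp_top_comp {X : Type*} [MeasurableSpace X] {π : α → X} (hπ : Measurable π)
    {u : X → ℂ} (hu : Measurable u) {C : ℝ} (hC : ∀ x, ‖u x‖ ≤ C) :
    MemLp (fun x => u (π x)) ∞ μ :=
  memLp_top_of_bound (hu.comp hπ).aestronglyMeasurable C
    (Filter.Eventually.of_forall fun _ => hC _)

theorem memLp_top_boundedContinuous_comp {X : Type*} [TopologicalSpace X] [MeasurableSpace X]
    [OpensMeasurableSpace X] {π : α → X} (hπ : Measurable π) (a : X →ᵇ ℂ) :
    MemLp (fun x => a (π x)) ∞ μ :=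
  memLp_top_comp hπ a.continuous.measurable a.norm_coe_le_norm

/-- If `T` commutes with multiplication by enough functions of `π` (closed under conjugation)
to separate points, then `T` commutes with multiplication by all bounded measurable functions
of `π`. -/
theorem commute_mulOperator_comp_of_separating {X : Type*} [PseudoEMetricSpace X] [CompleteSpace X]
    [SecondCountableTopology X] [MeasurableSpace X] [BorelSpace X]
    (T : Lp ℂ 2 μ →L[ℂ] Lp ℂ 2 μ) {π : α → X} (hπ : Measurable π)
    (hsep : ∀ x y : X, x ≠ y → ∃ a : X →ᵇ ℂ, a x ≠ a y ∧
      Commute T (mulOperator (μ := μ) (memLp_top_boundedContinuous_comp hπ a)) ∧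
      Commute T (mulOperator (μ := μ) (memLp_top_boundedContinuous_comp hπ (star a))))
    {u : X → ℂ} (hu : Measurable u) {C : ℝ} (hC : ∀ x, ‖u x‖ ≤ C) :
    Commute T (mulOperator (μ := μ) (memLp_top_comp hπ hu hC)) := by
  let M : (X →ᵇ ℂ) → (Lp ℂ 2 μ →L[ℂ] Lp ℂ 2 μ) := fun a =>
    mulOperator (memLp_top_boundedContinuous_comp hπ a)
  have hMmul : ∀ a b, M (a * b) = M a * M b := fun a b => mulOperator_comp _ _ _
  have hMadd : ∀ a b, M (a + b) = M a + M b := fun a b => mulOperator_add _ _ _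
  have hMalg : ∀ c : ℂ, M (algebraMap ℂ _ c) = c • 1 := fun c => mulOperator_const c _
  let 𝒜 : StarSubalgebra ℂ (X →ᵇ ℂ) :=
    { carrier := {a | Commute T (M a) ∧ Commute T (M (star a))}
      mul_mem' := by
        rintro a b ⟨ha, ha'⟩ ⟨hb, hb'⟩
        refine ⟨?_, ?_⟩
        · rw [hMmul]; exact ha.mul_right hb
        · rw [star_mul, hMmul]; exact hb'.mul_right ha'
      add_mem' := by
        rintro a b ⟨ha, ha'⟩ ⟨hb, hb'⟩
        refine ⟨?_, ?_⟩
        · rw [hMadd]; exact ha.add_right hb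
        · rw [star_add, hMadd]; exact ha'.add_right hb'
      algebraMap_mem' := by
        intro c
        refine ⟨?_, ?_⟩
        · rw [hMalg]; exact (Commute.one_right T).smul_right c
        · rw [← algebraMap_star_comm, hMalg]; exact (Commute.one_right T).smul_right _
      star_mem' := by
        rintro a ⟨ha, ha'⟩
        exact ⟨ha', by rwa [star_star]⟩ }
  have h𝒜 : (𝒜.map (BoundedContinuousFunction.toContinuousMapStarₐ ℂ)).SeparatesPoints := by
    intro x y hxy
    obtain ⟨a, hne, h1, h2⟩ := hsep x y hxy
    exact ⟨a, ⟨a.toContinuousMap, ⟨a, ⟨h1, h2⟩, rfl⟩, rfl⟩, hne⟩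
  rw [commute_mulOperator_iff]
  intro f g
  exact integral_comp_mul_eq_zero_of_separatesPoints hπ h𝒜 (integrable_commutatorDensity T f g)
    (fun a ha => (commute_mulOperator_iff T _).1 ha.1 f g) hu hC

theorem exists_memLp_two_ne_zero (μ : Measure α) [SigmaFinite μ] :
    ∃ g : α → ℂ, Measurable g ∧ MemLp g 2 μ ∧ ∀ x, g x ≠ 0 := by
  obtain ⟨g, hpos, hg, h_int⟩ := exists_pos_lintegral_lt_of_sigmaFinite μ (ε := 1) one_ne_zero
  have hm : Measurable fun x => ((NNReal.sqrt (g x) : ℝ) : ℂ) :=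
    Complex.measurable_ofReal.comp (measurable_coe_nnreal_real.comp
      (NNReal.continuous_sqrt.measurable.comp hg))
  refine ⟨fun x => ((NNReal.sqrt (g x) : ℝ) : ℂ), hm, ?_, fun x => ?_⟩
  · rw [memLp_two_iff_integrable_sq_norm hm.aestronglyMeasurable]
    have : (fun x => ‖((NNReal.sqrt (g x) : ℝ) : ℂ)‖ ^ 2) = fun x => (g x : ℝ) := by
      funext x
      rw [Complex.norm_real, NNReal.norm_eq, ← NNReal.coe_pow, NNReal.sq_sqrt]
    rw [this]
    refine ⟨(measurable_coe_nnreal_real.comp hg).aestronglyMeasurable, ?_⟩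
    rw [hasFiniteIntegral_iff_enorm]
    simpa using h_int.trans ENNReal.one_lt_top
  · simp [(hpos x).ne']

theorem mulOperator_injective [SigmaFinite μ] {u v : α → ℂ} (hu : MemLp u ∞ μ) (hv : MemLp v ∞ μ)
    (h : mulOperator hu = mulOperator hv) : u =ᵐ[μ] v := by
  obtain ⟨g, -, hg, hg0⟩ := exists_memLp_two_ne_zero μ
  have h1 := coeFn_mulOperator hu (hg.toLp g)
  rw [h] at h1
  filter_upwards [h1, coeFn_mulOperator hv (hg.toLp g), hg.coeFn_toLp] with x h2 h3 h4
  rw [h3, h4] at h2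
  exact (mul_right_cancel₀ (hg0 x) h2).symm

theorem memLp_top_indicator_one {S : Set α} (hS : MeasurableSet S) :
    MemLp (S.indicator fun _ => (1 : ℂ)) ∞ μ :=
  (memLp_top_const (1 : ℂ)).indicator hS

theorem norm_sq_mulOperator_indicator {S : Set α} (hS : MeasurableSet S)
    (hu : MemLp (S.indicator fun _ => (1 : ℂ)) ∞ μ) (f : Lp ℂ 2 μ) :
    ‖mulOperator hu f‖ ^ 2 = ∫ x in S, ‖f x‖ ^ 2 ∂μ := by
  have h := L2.inner_def (𝕜 := ℂ) (mulOperator hu f) (mulOperator hu f)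
  rw [inner_self_eq_norm_sq_to_K] at h
  have hcast : ((‖mulOperator hu f‖ ^ 2 : ℝ) : ℂ) = ((∫ x in S, ‖f x‖ ^ 2 ∂μ : ℝ) : ℂ) := by
    rw [Complex.ofReal_pow]
    refine h.trans ?_
    rw [← integral_indicator hS, ← integral_complex_ofReal]
    refine integral_congr_ae ?_
    filter_upwards [coeFn_mulOperator hu f] with x hx
    rw [hx, inner_self_eq_norm_sq_to_K]
    by_cases hxS : x ∈ S <;> simp [hxS]
  exact_mod_cast hcast

/-- The algebra of bounded multiplication operators is maximal abelian. -/
theorem exists_eq_mulOperator_of_commute [SigmaFinite μ] (T : Lp ℂ 2 μ →L[ℂ] Lp ℂ 2 μ)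
    (hT : ∀ (u : α → ℂ) (hu : MemLp u ∞ μ), Measurable u → (∃ C : ℝ, ∀ x, ‖u x‖ ≤ C) →
      Commute T (mulOperator hu)) :
    ∃ (m : α → ℂ) (_ : Measurable m) (hm : MemLp m ∞ μ), (∀ x, ‖m x‖ ≤ ‖T‖) ∧
      T = mulOperator hm := by
  obtain ⟨g, hgm, hg, hg0⟩ := exists_memLp_two_ne_zero μ
  set G := hg.toLp g with hG
  set k : α → ℂ := ⇑(T G) with hk
  have hkm : Measurable k := (Lp.stronglyMeasurable _).measurable
  let S : Set α := {x | ‖T‖ * ‖g x‖ < ‖k x‖}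
  have hS : MeasurableSet S := measurableSet_lt (measurable_const.mul hgm.norm) hkm.norm
  have hS0 : ∀ᵐ x ∂μ, ‖k x‖ ≤ ‖T‖ * ‖g x‖ := by
    have hu := memLp_top_indicator_one (μ := μ) hS
    have hle : ‖mulOperator hu (T G)‖ ^ 2 ≤ ‖T‖ ^ 2 * ‖mulOperator hu G‖ ^ 2 := by
      rw [← mul_apply_eq_comp, ← (hT _ hu (measurable_const.indicator hS)
          ⟨1, norm_indicator_one_le S⟩).eq, mul_apply_eq_comp, ← mul_pow]
      gcongr
      exact T.le_opNorm _
    have hGi : IntegrableOn (fun x => ‖g x‖ ^ 2) S μ :=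
      ((memLp_two_iff_integrable_sq_norm hg.1).1 hg).integrableOn
    have hki : IntegrableOn (fun x => ‖k x‖ ^ 2) S μ :=
      ((memLp_two_iff_integrable_sq_norm (Lp.memLp _).1).1 (Lp.memLp (T G))).integrableOn
    rw [norm_sq_mulOperator_indicator hS hu, norm_sq_mulOperator_indicator hS hu] at hle
    have hGg : ∫ x in S, ‖G x‖ ^ 2 ∂μ = ∫ x in S, ‖g x‖ ^ 2 ∂μ := by
      refine integral_congr_ae (ae_restrict_of_ae ?_)
      filter_upwards [hg.coeFn_toLp] with x hx
      rw [hG, hx]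
    rw [hGg, ← integral_const_mul, ← sub_nonpos, ← integral_sub hki (hGi.const_mul _)] at hle
    have hpos : ∀ x ∈ S, 0 < ‖k x‖ ^ 2 - ‖T‖ ^ 2 * ‖g x‖ ^ 2 := by
      intro x hx
      rw [← mul_pow, sub_pos]
      exact pow_lt_pow_left₀ hx (by positivity) two_ne_zero
    have hzero := (setIntegral_eq_zero_iff_of_nonneg_ae
      (ae_restrict_of_forall_mem hS fun x hx => (hpos x hx).le)
      (hki.sub (hGi.const_mul _))).1
      (le_antisymm hle (setIntegral_nonneg hS fun x hx => (hpos x hx).le))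
    rw [Filter.EventuallyEq, ae_restrict_iff' hS] at hzero
    filter_upwards [hzero] with x hx
    by_contra hlt
    have hxS : x ∈ S := not_le.1 hlt
    exact (hpos x hxS).ne' (hx hxS)
  let m : α → ℂ := fun x => if ‖k x‖ ≤ ‖T‖ * ‖g x‖ then k x / g x else 0
  have hmm : Measurable m := Measurable.ite
    (measurableSet_le hkm.norm (measurable_const.mul hgm.norm)) (hkm.div hgm) measurable_const
  have hmb : ∀ x, ‖m x‖ ≤ ‖T‖ := by
    intro x
    simp only [m]
    split_ifs with h
    · rw [norm_div]
      exact div_le_of_le_mul₀ (norm_nonneg _) (norm_nonneg _) h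
    · simp
  have hm : MemLp m ∞ μ := memLp_top_of_bound hmm.aestronglyMeasurable _
    (Filter.Eventually.of_forall hmb)
  refine ⟨m, hmm, hm, hmb, ?_⟩
  have hTm : T G = mulOperator hm G := by
    ext1
    filter_upwards [coeFn_mulOperator hm G, hS0, hg.coeFn_toLp] with x h2 h3 h4
    rw [h2, hG, h4]
    simp only [m, if_pos h3]
    exact (div_mul_cancel₀ _ (hg0 x)).symm
  have hagree : ∀ (u : α → ℂ) (hu : MemLp u ∞ μ), Measurable u → (∃ C : ℝ, ∀ x, ‖u x‖ ≤ C) →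
      T (mulOperator hu G) = mulOperator hm (mulOperator hu G) := by
    intro u hu hum hub
    rw [← mul_apply_eq_comp, (hT u hu hum hub).eq, mul_apply_eq_comp, hTm]
    ext1
    filter_upwards [coeFn_mulOperator hu (mulOperator hm G), coeFn_mulOperator hm G,
      coeFn_mulOperator hm (mulOperator hu G), coeFn_mulOperator hu G] with x h1 h2 h3 h4
    rw [h1, h2, h3, h4]
    ring
  ext1 f
  ext1
  have hn : ∀ n : ℕ, ∀ᵐ x ∂μ, ‖f x‖ ≤ n * ‖g x‖ → T f x = m x * f x := by
    intro n
    have hfm : Measurable f := (Lp.stronglyMeasurable f).measurable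
    have hSn : MeasurableSet {x | ‖f x‖ ≤ n * ‖g x‖} :=
      measurableSet_le hfm.norm (measurable_const.mul hgm.norm)
    have h1 := memLp_top_indicator_one (μ := μ) hSn
    let u : α → ℂ := fun x => if ‖f x‖ ≤ n * ‖g x‖ then f x / g x else 0
    have hum : Measurable u := Measurable.ite hSn (hfm.div hgm) measurable_const
    have hub : ∀ x, ‖u x‖ ≤ n := by
      intro x
      simp only [u]
      split_ifs with h
      · rw [norm_div]
        exact div_le_of_le_mul₀ (norm_nonneg _) n.cast_nonneg h
      · simp
    have hu : MemLp u ∞ μ := memLp_top_of_bound hum.aestronglyMeasurable _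
      (Filter.Eventually.of_forall hub)
    have heq : mulOperator hu G = mulOperator h1 f := by
      ext1
      filter_upwards [coeFn_mulOperator hu G, coeFn_mulOperator h1 f, hg.coeFn_toLp] with x h2 h3 h4
      rw [h2, h3, hG, h4]
      by_cases h : ‖f x‖ ≤ n * ‖g x‖
      · simp [u, h, hg0 x]
      · simp [u, h]
    have hcomm := hagree u hu hum ⟨n, hub⟩
    rw [heq, ← mul_apply_eq_comp, (hT _ h1 (measurable_const.indicator hSn)
      ⟨1, norm_indicator_one_le _⟩).eq, mul_apply_eq_comp] at hcomm
    have hae := coeFn_mulOperator h1 (T f)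
    rw [hcomm] at hae
    filter_upwards [hae, coeFn_mulOperator hm (mulOperator h1 f), coeFn_mulOperator h1 f]
      with x h2 h3 h4 h5
    rw [h3, h4] at h2
    simpa [Set.indicator, h5] using h2.symm
  filter_upwards [ae_all_iff.2 hn, coeFn_mulOperator hm f] with x h1 h2
  rw [h2]
  obtain ⟨n, hn⟩ := exists_nat_ge (‖f x‖ / ‖g x‖)
  exact h1 n ((div_le_iff₀ (norm_pos_iff.2 (hg0 x))).1 hn)

end Multiplication

section Translation

variable {E : Type*} [NormedAddCommGroup E] [InnerProductSpace ℝ E]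

/-- The unitary character `x ↦ exp (2πi ⟪ξ, x⟫)`. -/
noncomputable def unitaryCharacter (ξ : E) : E →ᵇ ℂ :=
  BoundedContinuousFunction.ofNormedAddCommGroup (fun x => ((𝐞 (inner ℝ ξ x) : Circle) : ℂ))
    (by fun_prop) 1 (fun _ => (Circle.norm_coe _).le)

theorem unitaryCharacter_apply (ξ x : E) :
    unitaryCharacter ξ x = ((𝐞 (inner ℝ ξ x) : Circle) : ℂ) := rfl

variable [FiniteDimensional ℝ E] [MeasurableSpace E] [BorelSpace E]

/-- Translation by `x` on `L²(E)`. -/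
noncomputable def translation (x : E) :
    Lp ℂ 2 (volume : Measure E) →L[ℂ] Lp ℂ 2 (volume : Measure E) :=
  (Lp.compMeasurePreservingₗᵢ ℂ (fun y => y - x)
    (measurePreserving_sub_right volume x)).toContinuousLinearMap

theorem coeFn_translation (x : E) (f : Lp ℂ 2 (volume : Measure E)) :
    translation x f =ᵐ[volume] fun y => f (y - x) :=
  Lp.coeFn_compMeasurePreserving f (measurePreserving_sub_right volume x)

theorem ae_comp_sub {p : E → Prop} (h : ∀ᵐ y ∂(volume : Measure E), p y) (x : E) :
    ∀ᵐ y ∂(volume : Measure E), p (y - x) :=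
  (measurePreserving_sub_right volume x).quasiMeasurePreserving.ae h

theorem translation_add (x y : E) :
    translation (x + y) = translation x * translation y := by
  ext f
  filter_upwards [coeFn_translation (x + y) f, coeFn_translation x (translation y f),
    ae_comp_sub (coeFn_translation y f) x] with t h1 h2 h3
  rw [h1, mul_apply_eq_comp, h2, h3, sub_sub]

theorem translation_zero : translation (0 : E) = 1 := by
  ext f
  filter_upwards [coeFn_translation (0 : E) f] with t h1
  rw [h1, one_apply_eq_self, sub_zero]

theorem translation_mulOperator (x : E) {u : E → ℂ} (hu : MemLp u ∞ volume)
    (hu' : MemLp (fun y => u (y - x)) ∞ volume) :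
    translation x * mulOperator hu = mulOperator hu' * translation x := by
  ext f
  filter_upwards [coeFn_translation x (mulOperator hu f), ae_comp_sub (coeFn_mulOperator hu f) x,
    coeFn_mulOperator hu' (translation x f), coeFn_translation x f] with y h1 h2 h3 h4
  rw [mul_apply_eq_comp, mul_apply_eq_comp, h1, h2, h3, h4]

theorem memLp_top_boundedContinuous (a : E →ᵇ ℂ) : MemLp a ∞ (volume : Measure E) :=
  memLp_top_boundedContinuous_comp measurable_id a

theorem fourier_comp_sub (f : E → ℂ) (x w : E) :
    𝓕 (fun y => f (y - x)) w = unitaryCharacter (-x) w * 𝓕 f w := by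
  rw [Real.fourier_eq, Real.fourier_eq, ← integral_const_mul,
    ← integral_add_right_eq_self _ x]
  refine integral_congr_ae (Filter.Eventually.of_forall fun y => ?_)
  simp only [unitaryCharacter_apply, add_sub_cancel_right, Circle.smul_def, smul_eq_mul]
  rw [← mul_assoc, ← Circle.coe_mul, ← AddChar.map_add_eq_mul, inner_add_left, inner_neg_left,
    neg_add_rev]

theorem fourierInv_comp_sub (f : E → ℂ) (x w : E) :
    𝓕⁻ (fun y => f (y - x)) w = unitaryCharacter x w * 𝓕⁻ f w := by
  rw [Real.fourierInv_eq_fourier_neg, Real.fourierInv_eq_fourier_neg, fourier_comp_sub,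
    unitaryCharacter_apply, unitaryCharacter_apply, inner_neg_neg]

theorem translation_toLp (f : SchwartzMap E ℂ) (x : E) :
    translation x (f.toLp 2) = (f.compSubConstCLM ℂ x).toLp 2 := by
  ext1
  filter_upwards [coeFn_translation x (f.toLp 2), ae_comp_sub (f.coeFn_toLp 2 volume) x,
    (f.compSubConstCLM ℂ x).coeFn_toLp 2] with y h1 h2 h3
  rw [h1, h2, h3, SchwartzMap.compSubConstCLM_apply]

theorem fourier_translation (x : E) (f : Lp ℂ 2 (volume : Measure E)) :
    𝓕 (translation x f) =
      mulOperator (memLp_top_boundedContinuous (unitaryCharacter (-x))) (𝓕 f) := by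
  have hdense := SchwartzMap.denseRange_toLpCLM (E := E) (F := ℂ) (μ := volume) (p := 2)
    ENNReal.ofNat_ne_top
  refine congrFun (hdense.equalizer
    ((Lp.fourierTransformₗᵢ E ℂ).continuous.comp (translation x).continuous)
    ((mulOperator (memLp_top_boundedContinuous (unitaryCharacter (-x)))).continuous.comp
      (Lp.fourierTransformₗᵢ E ℂ).continuous) (funext fun s => ?_)) f
  change 𝓕 (translation x (s.toLp 2)) = mulOperator _ (𝓕 (s.toLp 2))
  rw [translation_toLp, SchwartzMap.toLp_fourier_eq, SchwartzMap.toLp_fourier_eq]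
  ext1
  filter_upwards [(𝓕 (s.compSubConstCLM ℂ x)).coeFn_toLp 2, (𝓕 s).coeFn_toLp 2,
    coeFn_mulOperator (memLp_top_boundedContinuous (unitaryCharacter (-x))) ((𝓕 s).toLp 2)]
    with w h1 h2 h3
  rw [h1, h3, h2, SchwartzMap.fourier_coe, SchwartzMap.fourier_coe]
  exact fourier_comp_sub s x w

theorem fourierInv_translation (x : E) (f : Lp ℂ 2 (volume : Measure E)) :
    𝓕⁻ (translation x f) =
      mulOperator (memLp_top_boundedContinuous (unitaryCharacter x)) (𝓕⁻ f) := by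
  have hdense := SchwartzMap.denseRange_toLpCLM (E := E) (F := ℂ) (μ := volume) (p := 2)
    ENNReal.ofNat_ne_top
  refine congrFun (hdense.equalizer
    ((Lp.fourierTransformₗᵢ E ℂ).symm.continuous.comp (translation x).continuous)
    ((mulOperator (memLp_top_boundedContinuous (unitaryCharacter x))).continuous.comp
      (Lp.fourierTransformₗᵢ E ℂ).symm.continuous) (funext fun s => ?_)) f
  change 𝓕⁻ (translation x (s.toLp 2)) = mulOperator _ (𝓕⁻ (s.toLp 2))
  rw [translation_toLp, SchwartzMap.toLp_fourierInv_eq, SchwartzMap.toLp_fourierInv_eq]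
  ext1
  filter_upwards [(𝓕⁻ (s.compSubConstCLM ℂ x)).coeFn_toLp 2, (𝓕⁻ s).coeFn_toLp 2,
    coeFn_mulOperator (memLp_top_boundedContinuous (unitaryCharacter x)) ((𝓕⁻ s).toLp 2)]
    with w h1 h2 h3
  rw [h1, h3, h2, SchwartzMap.fourierInv_coe, SchwartzMap.fourierInv_coe]
  exact fourierInv_comp_sub s x w

/-- Conjugation of an operator by the Fourier transform. -/
noncomputable def fourierConj (T : Lp ℂ 2 (volume : Measure E) →L[ℂ] Lp ℂ 2 (volume : Measure E)) :
    Lp ℂ 2 (volume : Measure E) →L[ℂ] Lp ℂ 2 (volume : Measure E) :=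
  (Lp.fourierTransformₗᵢ E ℂ).toContinuousLinearEquiv.toContinuousLinearMap ∘L T ∘L
    (Lp.fourierTransformₗᵢ E ℂ).symm.toContinuousLinearEquiv.toContinuousLinearMap

theorem fourierConj_apply (T : Lp ℂ 2 (volume : Measure E) →L[ℂ] Lp ℂ 2 (volume : Measure E))
    (f : Lp ℂ 2 (volume : Measure E)) : fourierConj T f = 𝓕 (T (𝓕⁻ f)) := rfl

theorem fourierConj_mul (S T : Lp ℂ 2 (volume : Measure E) →L[ℂ] Lp ℂ 2 (volume : Measure E)) :
    fourierConj (S * T) = fourierConj S * fourierConj T := by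
  ext1 f
  simp only [mul_apply_eq_comp, fourierConj_apply, FourierTransform.fourierInv_fourier_eq]

theorem fourierConj_injective :
    Function.Injective (fourierConj (E := E)) := by
  intro S T h
  ext1 f
  have h' := congrArg (fun R => 𝓕⁻ (R (𝓕 f))) h
  simpa only [fourierConj_apply, FourierTransform.fourierInv_fourier_eq] using h'

theorem commute_fourierConj_iff
    {S T : Lp ℂ 2 (volume : Measure E) →L[ℂ] Lp ℂ 2 (volume : Measure E)} :
    Commute (fourierConj S) (fourierConj T) ↔ Commute S T := by
  rw [commute_iff_eq, commute_iff_eq, ← fourierConj_mul, ← fourierConj_mul,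
    fourierConj_injective.eq_iff]

theorem fourierConj_translation (x : E) :
    fourierConj (translation x) =
      mulOperator (memLp_top_boundedContinuous (unitaryCharacter (-x))) := by
  ext1 f
  rw [fourierConj_apply, fourier_translation, FourierTransform.fourier_fourierInv_eq]

theorem fourierConj_unitaryCharacter (ξ : E) :
    fourierConj (mulOperator (memLp_top_boundedContinuous (unitaryCharacter ξ))) =
      translation ξ := by
  ext1 f
  rw [fourierConj_apply, ← fourierInv_translation, FourierTransform.fourier_fourierInv_eq]

end Translation

section Annihilator

variable {E : Type*} [NormedAddCommGroup E] [InnerProductSpace ℝ E]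

/-- The annihilator of a set under the pairing `(z, ξ) ↦ exp (2πi ⟪z, ξ⟫)`. -/
def annihilator (Γ : Set E) : AddSubgroup E where
  carrier := {ξ | ∀ z ∈ Γ, unitaryCharacter z ξ = 1}
  zero_mem' := by
    intro z _
    simp [unitaryCharacter_apply]
  add_mem' := by
    intro a b ha hb z hz
    have h1 := ha z hz
    have h2 := hb z hz
    simp only [unitaryCharacter_apply] at h1 h2 ⊢
    rw [inner_add_right, AddChar.map_add_eq_mul, Circle.coe_mul, h1, h2, one_mul]
  neg_mem' := by
    intro a ha z hz
    have h1 := ha z hz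
    simp only [unitaryCharacter_apply] at h1 ⊢
    rw [inner_neg_right, AddChar.map_neg_eq_inv, Circle.coe_inv, h1, inv_one]

theorem unitaryCharacter_add_right (z x y : E) :
    unitaryCharacter z (x + y) = unitaryCharacter z x * unitaryCharacter z y := by
  simp only [unitaryCharacter_apply]
  rw [inner_add_right, AddChar.map_add_eq_mul, Circle.coe_mul]

theorem star_unitaryCharacter (z : E) : star (unitaryCharacter z) = unitaryCharacter (-z) := by
  ext x
  simp only [BoundedContinuousFunction.star_apply, unitaryCharacter_apply, inner_neg_left,
    AddChar.map_neg_eq_inv, Circle.coe_inv_eq_conj]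
  rfl

theorem exists_unitaryCharacter_ne {x y : E} (hxy : x ≠ y) :
    ∃ z : E, unitaryCharacter z x ≠ unitaryCharacter z y := by
  refine ⟨(1 / (2 * ‖x - y‖ ^ 2)) • (x - y), fun heq => ?_⟩
  have hne : ‖x - y‖ ≠ 0 := norm_ne_zero_iff.2 (sub_ne_zero.2 hxy)
  have h := unitaryCharacter_add_right ((1 / (2 * ‖x - y‖ ^ 2)) • (x - y)) (x - y) y
  rw [sub_add_cancel, heq] at h
  have h0 : unitaryCharacter ((1 / (2 * ‖x - y‖ ^ 2)) • (x - y)) y ≠ 0 := Circle.coe_ne_zero _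
  have h1 : unitaryCharacter ((1 / (2 * ‖x - y‖ ^ 2)) • (x - y)) (x - y) = 1 :=
    (mul_right_cancel₀ h0 (by rw [one_mul]; exact h)).symm
  rw [unitaryCharacter_apply, real_inner_smul_left, real_inner_self_eq_norm_sq,
    Real.fourierChar_apply] at h1
  have e : ((2 * Real.pi * (1 / (2 * ‖x - y‖ ^ 2) * ‖x - y‖ ^ 2) : ℝ) : ℂ) * Complex.I =
      Real.pi * Complex.I := by
    congr 2
    field_simp
  rw [e, Complex.exp_pi_mul_I] at h1
  norm_num at h1

theorem isClosed_annihilator (Γ : Set E) : IsClosed (annihilator Γ : Set E) := by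
  have : (annihilator Γ : Set E) = ⋂ z ∈ Γ, {ξ | unitaryCharacter z ξ = 1} := by
    ext ξ
    simp [annihilator]
  rw [this]
  exact isClosed_biInter fun z _ =>
    isClosed_eq (unitaryCharacter z).continuous continuous_const

/-- A bounded continuous function invariant under a subgroup, as a function on the quotient. -/
noncomputable def quotientLift (H : AddSubgroup E) (a : E →ᵇ ℂ)
    (ha : ∀ x, ∀ h ∈ H, a (x + h) = a x) : (E ⧸ H) →ᵇ ℂ :=
  BoundedContinuousFunction.ofNormedAddCommGroup
    (Quotient.lift a fun x y hxy => by
      rw [← ha x (-x + y) (QuotientAddGroup.leftRel_apply.1 hxy)]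
      simp)
    (continuous_quot_lift _ a.continuous) ‖a‖
    (fun q => Quotient.inductionOn q fun x => a.norm_coe_le_norm x)

variable [FiniteDimensional ℝ E] [MeasurableSpace E] [BorelSpace E]

/-- If `T` commutes with multiplication by a conjugation-closed family of `H`-invariant bounded
continuous functions separating the cosets of the closed subgroup `H`, then `T` commutes with
multiplication by every `H`-invariant bounded continuous function. -/
theorem commute_mulOperator_of_invariant (H : AddSubgroup E) (hH : IsClosed (H : Set E))
    (T : Lp ℂ 2 (volume : Measure E) →L[ℂ] Lp ℂ 2 (volume : Measure E))
    (hsep : ∀ x y : E, x - y ∉ H → ∃ a : E →ᵇ ℂ, (∀ x, ∀ h ∈ H, a (x + h) = a x) ∧ a x ≠ a y ∧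
      Commute T (mulOperator (memLp_top_boundedContinuous a)) ∧
      Commute T (mulOperator (memLp_top_boundedContinuous (star a))))
    (b : E →ᵇ ℂ) (hb : ∀ x, ∀ h ∈ H, b (x + h) = b x) :
    Commute T (mulOperator (memLp_top_boundedContinuous b)) := by
  have : IsClosed (H : Set E) := hH
  have hπ : Measurable (QuotientAddGroup.mk : E → E ⧸ H) :=
    QuotientAddGroup.continuous_mk.measurable
  have : SecondCountableTopology (E ⧸ H) := inferInstance
  have : CompleteSpace (E ⧸ H) := inferInstance
  refine commute_mulOperator_comp_of_separating T hπ ?_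
    (quotientLift H b hb).continuous.measurable (quotientLift H b hb).norm_coe_le_norm
  intro p q
  induction p using QuotientAddGroup.induction_on with | H x => ?_
  induction q using QuotientAddGroup.induction_on with | H y => ?_
  intro hxy
  have hxy' : y - x ∉ H := by
    intro h
    refine hxy (QuotientAddGroup.eq.2 ?_)
    rwa [neg_add_eq_sub]
  obtain ⟨a, ha, hne, h1, h2⟩ := hsep y x hxy'
  exact ⟨quotientLift H a ha, hne.symm, h1, h2⟩

theorem norm_convolution_normed_le (φ : ContDiffBump (0 : E)) {m : E → ℂ} {C : ℝ}
    (hm : ∀ x, ‖m x‖ ≤ C) (x : E) :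
    ‖(φ.normed volume ⋆[ContinuousLinearMap.lsmul ℝ ℝ, volume] m) x‖ ≤ C :=
  calc ‖(φ.normed volume ⋆[ContinuousLinearMap.lsmul ℝ ℝ, volume] m) x‖
      ≤ ∫ t, φ.normed volume t * C := by
        refine norm_integral_le_of_norm_le (φ.integrable_normed.mul_const _)
          (Eventually.of_forall fun t => ?_)
        rw [ContinuousLinearMap.lsmul_apply, norm_smul, Real.norm_of_nonneg (φ.nonneg_normed t)]
        exact mul_le_mul_of_nonneg_left (hm _) (φ.nonneg_normed t)
    _ = C := by rw [integral_mul_const, φ.integral_normed, one_mul]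

/-- If `T` commutes with all translations and with multiplication by characters trivial on `Γ`,
then `T` lies in the bicommutant of the translations by elements of `Γ`. -/
theorem commute_of_commute_translation (Γ : Set E)
    (hneg : ∀ z ∈ Γ, -z ∈ Γ)
    {T S : Lp ℂ 2 (volume : Measure E) →L[ℂ] Lp ℂ 2 (volume : Measure E)}
    (hTW : ∀ x, Commute T (translation x))
    (hTe : ∀ ξ ∈ annihilator Γ,
      Commute T (mulOperator (memLp_top_boundedContinuous (unitaryCharacter ξ))))
    (hS : ∀ z ∈ Γ, Commute S (translation z)) : Commute T S := by
  rw [← commute_fourierConj_iff]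
  have hTe' : ∀ ξ ∈ annihilator Γ, Commute (fourierConj T) (translation ξ) := by
    intro ξ hξ
    rw [← fourierConj_unitaryCharacter, commute_fourierConj_iff]
    exact hTe ξ hξ
  have hTW' : ∀ x, Commute (fourierConj T)
      (mulOperator (memLp_top_boundedContinuous (unitaryCharacter x))) := by
    intro x
    have h := fourierConj_translation (-x)
    simp only [neg_neg] at h
    rw [← h, commute_fourierConj_iff]
    exact hTW _
  have hS' : ∀ z ∈ Γ, Commute (fourierConj S)
      (mulOperator (memLp_top_boundedContinuous (unitaryCharacter z))) := by
    intro z hz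
    have h := fourierConj_translation (-z)
    simp only [neg_neg] at h
    rw [← h, commute_fourierConj_iff]
    exact hS _ (hneg z hz)
  generalize fourierConj T = T at *
  generalize fourierConj S = S at *
  -- `T` is a multiplication operator
  have hTmul : ∀ (u : E → ℂ) (hu : MemLp u ∞ volume), Measurable u →
      (∃ C : ℝ, ∀ x, ‖u x‖ ≤ C) → Commute T (mulOperator hu) := by
    rintro u - hum ⟨C, hC⟩
    refine commute_mulOperator_comp_of_separating T measurable_id (fun x y hxy => ?_) hum hC
    obtain ⟨z, hz⟩ := exists_unitaryCharacter_ne hxy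
    refine ⟨unitaryCharacter z, hz, hTW' z, ?_⟩
    have := hTW' (-z)
    simpa only [star_unitaryCharacter] using this
  obtain ⟨m, hmm, hm, hmb, rfl⟩ := exists_eq_mulOperator_of_commute T hTmul
  have hinv : ∀ ξ ∈ annihilator Γ, ∀ᵐ x, m (x - ξ) = m x := by
    intro ξ hξ
    have hm' : MemLp (fun y => m (y - ξ)) ∞ volume :=
      hm.comp_measurePreserving (measurePreserving_sub_right volume ξ)
    have h := (hTe' ξ hξ).eq
    rw [translation_mulOperator ξ hm hm'] at h
    refine mulOperator_injective hm' hm ?_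
    have h2 := congrArg (· * translation (-ξ)) h
    simp only [mul_assoc, ← translation_add, add_neg_cancel, translation_zero, mul_one] at h2
    exact h2.symm
  refine Commute.symm ((commute_mulOperator_iff S hm).2 fun f g => ?_)
  have hloc : LocallyIntegrable m volume := hm.locallyIntegrable le_top
  let φ : ℕ → ContDiffBump (0 : E) := fun n =>
    { rIn := 1 / (n + 1), rOut := 2 / (n + 1), rIn_pos := by positivity,
      rIn_lt_rOut := by gcongr; norm_num }
  let mφ : ℕ → E → ℂ := fun n => (φ n).normed volume ⋆[ContinuousLinearMap.lsmul ℝ ℝ, volume] m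
  have hcont : ∀ n, Continuous (mφ n) := fun n =>
    (φ n).hasCompactSupport_normed.continuous_convolution_left _ (φ n).continuous_normed hloc
  have hbound : ∀ n x, ‖mφ n x‖ ≤ ‖mulOperator hm‖ := fun n =>
    norm_convolution_normed_le (φ n) hmb
  have hinv' : ∀ n x, ∀ ξ ∈ annihilator Γ, mφ n (x + ξ) = mφ n x := by
    intro n x ξ hξ
    refine integral_congr_ae ?_
    filter_upwards [(Measure.measurePreserving_sub_left volume (x + ξ)).quasiMeasurePreserving.ae
      (hinv ξ hξ)] with t ht
    rw [← ht, show x + ξ - t - ξ = x - t by abel]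
  have hzero : ∀ n, ∫ x, mφ n x * commutatorDensity S f g x = 0 := by
    intro n
    let b : E →ᵇ ℂ := BoundedContinuousFunction.ofNormedAddCommGroup (mφ n) (hcont n) _ (hbound n)
    have hc := commute_mulOperator_of_invariant (annihilator Γ) (isClosed_annihilator Γ) S
      (fun x y hxy => ?_) b (hinv' n)
    · exact (commute_mulOperator_iff S _).1 hc f g
    · have : ∃ z ∈ Γ, unitaryCharacter z (x - y) ≠ 1 := by
        by_contra! h
        exact hxy h
      obtain ⟨z, hz, hne⟩ := this
      refine ⟨unitaryCharacter z, fun x h hh => ?_, fun heq => hne ?_, hS' z hz, ?_⟩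
      · rw [unitaryCharacter_add_right, hh z hz, mul_one]
      · have h1 := unitaryCharacter_add_right z (x - y) y
        rw [sub_add_cancel, heq] at h1
        have h0 : unitaryCharacter z y ≠ 0 := Circle.coe_ne_zero _
        exact (mul_right_cancel₀ h0 (by rw [one_mul]; exact h1)).symm
      · have := hS' (-z) (hneg z hz)
        simpa only [star_unitaryCharacter] using this
  have hlim : ∀ᵐ x, Tendsto (fun n => mφ n x) atTop (𝓝 (m x)) := by
    refine ContDiffBump.ae_convolution_tendsto_right_of_locallyIntegrable (K := 2) ?_ ?_ hloc
    · have h := (tendsto_one_div_add_atTop_nhds_zero_nat (𝕜 := ℝ)).const_mul 2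
      simpa [φ, div_eq_mul_inv] using h
    · refine Eventually.of_forall fun n => ?_
      simp only [φ]
      exact le_of_eq (by ring)
  have hk := integrable_commutatorDensity S f g
  have hconv : Tendsto (fun n => ∫ x, mφ n x * commutatorDensity S f g x) atTop
      (𝓝 (∫ x, m x * commutatorDensity S f g x)) := by
    refine tendsto_integral_of_dominated_convergence
      (fun x => ‖mulOperator hm‖ * ‖commutatorDensity S f g x‖) (fun n => ?_)
      (hk.norm.const_mul _) (fun n => ?_) ?_
    · exact (hcont n).aestronglyMeasurable.mul hk.1
    · refine Eventually.of_forall fun x => ?_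
      rw [norm_mul]
      gcongr
      exact hbound n x
    · filter_upwards [hlim] with x hx
      exact hx.mul_const _
  simp only [hzero] at hconv
  exact tendsto_nhds_unique hconv tendsto_const_nhds

end Annihilator

section Isotropy

variable {E : Type*} [NormedAddCommGroup E]

/-- The isotropy group of a set under translation. -/
def isotropy (A : Set E) : AddSubgroup E where
  carrier := {z | ∀ b, b + z ∈ A ↔ b ∈ A}
  zero_mem' := by simp
  add_mem' := by
    intro y z hy hz b
    rw [← add_assoc, hz, hy]
  neg_mem' := by
    intro z hz b
    rw [← hz (b + -z), neg_add_cancel_right]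

theorem mem_isotropy {A : Set E} {z : E} : z ∈ isotropy A ↔ ∀ b, b + z ∈ A ↔ b ∈ A := Iff.rfl

theorem mem_isotropy_iff_image_eq {A : Set E} {z : E} :
    z ∈ isotropy A ↔ (fun b => b + z) '' A = A := by
  rw [← neg_mem_iff, mem_isotropy, Set.image_add_right, Set.ext_iff]
  rfl

theorem mem_isotropy_iff_forall_mem {A : Set E} {z : E} :
    z ∈ isotropy A ↔ ∀ b ∈ A, b + z ∈ A ∧ b - z ∈ A := by
  refine ⟨fun h b hb => ⟨(h b).2 hb, ?_⟩, fun h b => ⟨fun hb => ?_, fun hb => (h b hb).1⟩⟩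
  · rw [← h, sub_add_cancel]
    exact hb
  · simpa using (h _ hb).2

theorem isClosed_isotropy {A : Set E} (hA : IsClosed A) : IsClosed (isotropy A : Set E) := by
  have : (isotropy A : Set E) = ⋂ b ∈ A, {z | b + z ∈ A} ∩ {z | b - z ∈ A} := by
    ext z
    simp only [SetLike.mem_coe, mem_isotropy_iff_forall_mem, Set.mem_iInter, Set.mem_inter_iff,
      Set.mem_ofPred_eq]
  rw [this]
  exact isClosed_biInter fun b _ => (hA.preimage (continuous_const.add continuous_id)).inter
    (hA.preimage (continuous_const.sub continuous_id))

variable [InnerProductSpace ℝ E] [FiniteDimensional ℝ E] [MeasurableSpace E] [BorelSpace E]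

theorem commute_mulOperator_convolution {u : E → ℂ} (hum : Measurable u) {C : ℝ}
    (hC : ∀ x, ‖u x‖ ≤ C) (T : Lp ℂ 2 (volume : Measure E) →L[ℂ] Lp ℂ 2 (volume : Measure E))
    (hT : ∀ (x : E) (hu : MemLp (fun y => u (y - x)) ∞ volume), Commute T (mulOperator hu))
    (φ : ContDiffBump (0 : E)) (c : E)
    {v : E → ℂ} (hv : MemLp v ∞ volume)
    (hvu : ∀ t, v t = (φ.normed volume ⋆[ContinuousLinearMap.lsmul ℝ ℝ, volume] u) (t + c)) :
    Commute T (mulOperator hv) := by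
  refine (commute_mulOperator_iff T hv).2 fun f g => ?_
  have hk := integrable_commutatorDensity T f g
  set k := commutatorDensity T f g
  have h_int : Integrable (Function.uncurry fun t s : E =>
      u (t + c - s) * (k t * (φ.normed volume s : ℂ))) (volume.prod volume) := by
    refine (hk.mul_prod φ.integrable_normed.ofReal).bdd_mul (c := C)
      (hum.comp (by fun_prop)).aestronglyMeasurable (Eventually.of_forall fun x => hC _)
  calc ∫ t, v t * k t = ∫ t, ∫ s, u (t + c - s) * (k t * (φ.normed volume s : ℂ)) := by
        refine integral_congr_ae (Eventually.of_forall fun t => ?_)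
        simp only [hvu, convolution, ContinuousLinearMap.lsmul_apply]
        rw [← integral_mul_const]
        refine integral_congr_ae (Eventually.of_forall fun s => ?_)
        simp only [Complex.real_smul]
        ring
    _ = ∫ s, ∫ t, u (t + c - s) * (k t * (φ.normed volume s : ℂ)) := integral_integral_swap h_int
    _ = 0 := by
        refine integral_eq_zero_of_ae (Eventually.of_forall fun s => ?_)
        have hs : MemLp (fun y => u (y - (s - c))) ∞ volume :=
          memLp_top_of_bound (hum.comp (by fun_prop)).aestronglyMeasurable C
            (Eventually.of_forall fun x => hC _)
        have h := (commute_mulOperator_iff T hs).1 (hT _ hs) f g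
        simp only [Pi.zero_apply, ← mul_assoc, integral_mul_const]
        rw [← zero_mul (φ.normed volume s : ℂ), ← h]
        congr 2
        ext t
        rw [sub_sub_eq_add_sub]

theorem exists_convolution_indicator_ne {A : Set E} (hA : IsClosed A) {a a' : E}
    (ha : a ∈ interior A) (ha' : a' ∉ A) : ∃ φ : ContDiffBump (0 : E),
      (φ.normed volume ⋆[ContinuousLinearMap.lsmul ℝ ℝ, volume]
        A.indicator fun _ => (1 : ℂ)) a ≠
      (φ.normed volume ⋆[ContinuousLinearMap.lsmul ℝ ℝ, volume]
        A.indicator fun _ => (1 : ℂ)) a' := by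
  obtain ⟨r, hr, hrA⟩ := Metric.isOpen_iff.1 isOpen_interior a ha
  obtain ⟨r', hr', hrA'⟩ := Metric.isOpen_iff.1 hA.isOpen_compl a' ha'
  have hpos : 0 < min r r' := lt_min hr hr'
  let φ : ContDiffBump (0 : E) := ⟨min r r' / 2, min r r', by positivity, by linarith⟩
  refine ⟨φ, ?_⟩
  have haA := interior_subset ha
  rw [φ.normed_convolution_eq_right, φ.normed_convolution_eq_right]
  · simp [haA, ha']
  · intro x hx
    have : x ∉ A := hrA' (Metric.ball_subset_ball (min_le_right _ _) hx)
    simp [this, ha']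
  · intro x hx
    have : x ∈ A := interior_subset (hrA (Metric.ball_subset_ball (min_le_left _ _) hx))
    simp [this, haA]

/-- If `T` commutes with multiplication by the indicators of all translates of `A`, then it
commutes with multiplication by the characters trivial on the isotropy group of `A`. -/
theorem commute_unitaryCharacter_of_commute_indicator {A : Set E} (hA : IsClosed A)
    (hreg : A ⊆ closure (interior A))
    (T : Lp ℂ 2 (volume : Measure E) →L[ℂ] Lp ℂ 2 (volume : Measure E))
    (hT : ∀ (x : E) (hu : MemLp (fun y => A.indicator (fun _ => (1 : ℂ)) (y - x)) ∞ volume),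
      Commute T (mulOperator hu)) {ξ : E} (hξ : ξ ∈ annihilator (isotropy A : Set E)) :
    Commute T (mulOperator (memLp_top_boundedContinuous (unitaryCharacter ξ))) := by
  set u : E → ℂ := A.indicator fun _ => 1
  have hum : Measurable u := measurable_const.indicator hA.measurableSet
  have hu1 : ∀ x, ‖u x‖ ≤ 1 := norm_indicator_one_le A
  have huG : ∀ x, ∀ h ∈ isotropy A, u (x + h) = u x := by
    intro x h hh
    by_cases hx : x ∈ A
    · simp [u, hx, (hh x).2 hx]
    · simp [u, hx, mt (hh x).1 hx]
  have hloc : LocallyIntegrable u volume :=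
    (memLp_top_indicator_one hA.measurableSet).locallyIntegrable le_top
  have hustar : ∀ x, conj (u x) = u x := by
    intro x
    by_cases hx : x ∈ A <;> simp [u, hx]
  refine commute_mulOperator_of_invariant (isotropy A) (isClosed_isotropy hA) T ?_ _ ?_
  swap
  · intro x h hh
    have h1 := hξ h hh
    rw [unitaryCharacter_apply, real_inner_comm, ← unitaryCharacter_apply] at h1
    rw [unitaryCharacter_add_right, h1, mul_one]
  have key : ∀ (c : E) (φ : ContDiffBump (0 : E)), ∃ b : E →ᵇ ℂ,
      (∀ t, b t = (φ.normed volume ⋆[ContinuousLinearMap.lsmul ℝ ℝ, volume] u) (t + c)) ∧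
      (∀ x, ∀ h ∈ isotropy A, b (x + h) = b x) ∧
      Commute T (mulOperator (memLp_top_boundedContinuous b)) ∧
      Commute T (mulOperator (memLp_top_boundedContinuous (star b))) := by
    intro c φ
    have hcont : Continuous (φ.normed volume ⋆[ContinuousLinearMap.lsmul ℝ ℝ, volume] u) :=
      φ.hasCompactSupport_normed.continuous_convolution_left _ φ.continuous_normed hloc
    let b : E →ᵇ ℂ := BoundedContinuousFunction.ofNormedAddCommGroup
      (fun t => (φ.normed volume ⋆[ContinuousLinearMap.lsmul ℝ ℝ, volume] u) (t + c))
      (hcont.comp (continuous_id.add continuous_const)) 1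
      (fun t => norm_convolution_normed_le φ hu1 _)
    have hb : ∀ t, b t = (φ.normed volume ⋆[ContinuousLinearMap.lsmul ℝ ℝ, volume] u) (t + c) :=
      fun _ => rfl
    have hbstar : star b = b := by
      ext t
      rw [BoundedContinuousFunction.star_apply, hb, convolution, ← starRingEnd_apply,
        ← integral_conj]
      simp only [ContinuousLinearMap.lsmul_apply, Complex.real_smul, map_mul, Complex.conj_ofReal,
        hustar]
    have hcomm := commute_mulOperator_convolution hum hu1 T hT φ c
      (memLp_top_boundedContinuous b) hb
    refine ⟨b, hb, fun x h hh => ?_, hcomm, by simpa only [hbstar] using hcomm⟩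
    simp only [hb, convolution]
    refine integral_congr_ae (Eventually.of_forall fun s => ?_)
    simp only
    rw [← huG (x + c - s) h hh]
    congr 2
    abel
  intro x y hxy
  have hex : ∃ c a a', a ∈ interior A ∧ a' ∉ A ∧
      ((a = y + c ∧ a' = x + c) ∨ (a = x + c ∧ a' = y + c)) := by
    rw [mem_isotropy_iff_forall_mem] at hxy
    push Not at hxy
    obtain ⟨b, hb, hbA⟩ := hxy
    by_cases h1 : b + (x - y) ∈ A
    · obtain ⟨a, ha', ha⟩ := mem_closure_iff.1 (hreg hb) {a | a - (x - y) ∉ A}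
        (hA.isOpen_compl.preimage (continuous_id.sub continuous_const)) (hbA h1)
      exact ⟨a - x, a, a - (x - y), ha, ha', Or.inr ⟨by abel, by abel⟩⟩
    · obtain ⟨a, ha', ha⟩ := mem_closure_iff.1 (hreg hb) {a | a + (x - y) ∉ A}
        (hA.isOpen_compl.preimage (continuous_id.add continuous_const)) h1
      exact ⟨a - y, a, a + (x - y), ha, ha', Or.inl ⟨by abel, by abel⟩⟩
  obtain ⟨c, a, a', ha, ha', h⟩ := hex
  obtain ⟨φ, hφ⟩ := exists_convolution_indicator_ne hA ha ha'
  obtain ⟨b, hb, hinv, h1, h2⟩ := key c φ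
  refine ⟨b, hinv, ?_, h1, h2⟩
  rw [hb, hb]
  rcases h with ⟨rfl, rfl⟩ | ⟨rfl, rfl⟩
  · exact hφ.symm
  · exact hφ

end Isotropy

section Dilation

variable {E H K : Type*} [AddCommGroup E]
  [NormedAddCommGroup H] [NormedSpace ℂ H] [NormedAddCommGroup K] [NormedSpace ℂ K]

/-- An operator commuting with a semigroup of compressions of a group representation by
contractions, and with their adjoints, lifts to the dilation space. -/
theorem exists_lift_of_commute_compression [CompleteSpace K] {ι : H →L[ℂ] K} {ρ : K →L[ℂ] H}
    (hρι : ρ ∘L ι = 1) {W : E → K →L[ℂ] K} (hW0 : W 0 = 1)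
    (hWadd : ∀ x y, W (x + y) = W x * W y) (hWnorm : ∀ x, ‖W x‖ ≤ 1)
    {P : AddSubmonoid E} {V X : E → H →L[ℂ] H}
    (hV : ∀ x ∈ P, W x ∘L ι = ι ∘L V x) (hX : ∀ x ∈ P, X x ∘L ρ = ρ ∘L W (-x))
    {p : E} (hp : p ∈ P)
    (hlim : ∀ f, Tendsto (fun n : ℕ => W (-(n • p)) (ι (ρ (W (n • p) f)))) atTop (𝓝 f))
    {T : H →L[ℂ] H} (hTV : ∀ x ∈ P, Commute T (V x)) (hTX : ∀ x ∈ P, Commute T (X x)) :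
    ∃ T' : K →L[ℂ] K, T' ∘L ι = ι ∘L T ∧ ρ ∘L T' = T ∘L ρ ∧ ∀ x ∈ P, Commute T' (W x) := by
  have hρι' : ∀ h, ρ (ι h) = h := fun h => congrArg (· h) hρι
  have hWadd' : ∀ x y f, W x (W y f) = W (x + y) f := fun x y f => by rw [hWadd]; rfl
  have hV' : ∀ x ∈ P, ∀ h, W x (ι h) = ι (V x h) := fun x hx h => congrArg (· h) (hV x hx)
  have hX' : ∀ x ∈ P, ∀ f, X x (ρ f) = ρ (W (-x) f) := fun x hx f => congrArg (· f) (hX x hx)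
  have hTV' : ∀ x ∈ P, ∀ h, T (V x h) = V x (T h) := fun x hx h => congrArg (· h) (hTV x hx).eq
  have hTX' : ∀ x ∈ P, ∀ h, T (X x h) = X x (T h) := fun x hx h => congrArg (· h) (hTX x hx).eq
  have hnp : ∀ n : ℕ, n • p ∈ P := fun n => nsmul_mem hp n
  let Q : ℕ → H →L[ℂ] K := fun n => W (-(n • p)) ∘L ι
  let R : ℕ → K →L[ℂ] H := fun n => ρ ∘L W (n • p)
  have hQ : ∀ n h, Q n h = W (-(n • p)) (ι h) := fun _ _ => rfl
  have hR : ∀ n f, R n f = ρ (W (n • p) f) := fun _ _ => rfl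
  let Tn : ℕ → K →L[ℂ] K := fun n => Q n ∘L T ∘L R n
  have hTn : ∀ n f, Tn n f = Q n (T (R n f)) := fun _ _ => rfl
  have hTQ : ∀ m n, m ≤ n → ∀ h, Tn n (Q m h) = Q m (T h) := by
    intro m n hmn h
    obtain ⟨k, rfl⟩ := Nat.exists_eq_add_of_le hmn
    rw [hTn, hR, hQ m h, hWadd', show (m + k) • p + -(m • p) = k • p by rw [add_nsmul]; abel,
      hV' _ (hnp k), hρι', hTV' _ (hnp k), hQ, ← hV' _ (hnp k), hWadd', hQ,
      show -((m + k) • p) + k • p = -(m • p) by rw [add_nsmul]; abel]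
  have hbound : ∀ n f, ‖Tn n f‖ ≤ ‖ι‖ * ‖T‖ * ‖ρ‖ * ‖f‖ := by
    intro n f
    have hW : ∀ x g, ‖W x g‖ ≤ ‖g‖ := fun x g => by
      simpa using (W x).le_of_opNorm_le (hWnorm x) g
    calc ‖Tn n f‖ ≤ ‖ι (T (ρ (W (n • p) f)))‖ := hW _ _
      _ ≤ ‖ι‖ * (‖T‖ * (‖ρ‖ * ‖f‖)) :=
        ι.le_opNorm_of_le (T.le_opNorm_of_le (ρ.le_opNorm_of_le (hW _ _)))
      _ = _ := by ring
  have hcauchy : ∀ f, CauchySeq fun n => Tn n f := by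
    intro f
    refine cauchySeq_of_le_tendsto_0' (fun n => ‖ι‖ * ‖T‖ * ‖ρ‖ * ‖Q n (R n f) - f‖)
      (fun n m hnm => ?_) ?_
    · rw [dist_eq_norm, hTn n, ← hTQ n m hnm, ← map_sub]
      exact hbound _ _
    · have := (tendsto_iff_norm_sub_tendsto_zero.1 (hlim f)).const_mul (‖ι‖ * ‖T‖ * ‖ρ‖)
      rwa [mul_zero] at this
  choose L hL using fun f => cauchySeq_tendsto_of_complete (hcauchy f)
  let T' : K →L[ℂ] K := continuousLinearMapOfTendsto Tn (tendsto_pi_nhds.2 hL)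
  have hT' : ∀ f, Tendsto (fun n => Tn n f) atTop (𝓝 (T' f)) := hL
  have hT'Q : ∀ m h, T' (Q m h) = Q m (T h) := by
    intro m h
    refine tendsto_nhds_unique (hT' _) (tendsto_const_nhds.congr' ?_)
    filter_upwards [eventually_ge_atTop m] with n hn
    exact (hTQ m n hn h).symm
  have hlimQ : ∀ f, Tendsto (fun n => Q n (R n f)) atTop (𝓝 f) := hlim
  refine ⟨T', ?_, ?_, fun x hx => ?_⟩
  · ext h
    have := hT'Q 0 h
    simpa [hQ, hW0] using this
  · ext f
    refine tendsto_nhds_unique (((ρ ∘L T').continuous.tendsto f).comp (hlimQ f))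
      ((((T ∘L ρ).continuous.tendsto f).comp (hlimQ f)).congr fun n => ?_)
    simp only [Function.comp_apply, ContinuousLinearMap.comp_apply, hT'Q]
    rw [hQ, hQ, ← hX' _ (hnp n), ← hX' _ (hnp n), hρι', hρι', hTX' _ (hnp n)]
  · ext f
    refine tendsto_nhds_unique (((T' * W x).continuous.tendsto f).comp (hlimQ f))
      ((((W x * T').continuous.tendsto f).comp (hlimQ f)).congr fun n => ?_)
    have hWQ : ∀ h, W x (Q n h) = Q n (V x h) := by
      intro h
      rw [hQ, hQ, hWadd', ← hV' x hx, hWadd', add_comm]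
    simp only [Function.comp_apply, mul_apply_eq_comp, hT'Q, hWQ, hTV' x hx]

end Dilation

section Restriction

variable {α : Type*} [MeasurableSpace α] {μ : Measure α}

/-- Extension by zero from `L²(A)`, the adjoint of restriction to `A`. -/
noncomputable def extendByZero (μ : Measure α) (A : Set α) :
    Lp ℂ 2 (μ.restrict A) →L[ℂ] Lp ℂ 2 μ :=
  ContinuousLinearMap.adjoint (LpToLpRestrictCLM α ℂ ℂ μ 2 A)

theorem coeFn_extendByZero {A : Set α} (hA : MeasurableSet A) (f : Lp ℂ 2 (μ.restrict A)) :
    extendByZero μ A f =ᵐ[μ] A.indicator f := by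
  have hf : MemLp (A.indicator f) 2 μ := (memLp_indicator_iff_restrict hA).2 (Lp.memLp f)
  have : extendByZero μ A f = hf.toLp _ := by
    refine ext_inner_left ℂ fun g => ?_
    rw [extendByZero, ContinuousLinearMap.adjoint_inner_right, L2.inner_def, L2.inner_def]
    calc ∫ x in A, inner ℂ (LpToLpRestrictCLM α ℂ ℂ μ 2 A g x) (f x) ∂μ
        = ∫ x in A, inner ℂ (g x) (f x) ∂μ := by
          refine integral_congr_ae ?_
          filter_upwards [LpToLpRestrictCLM_coeFn ℂ A g] with x hx
          rw [hx]
      _ = ∫ x, A.indicator (fun x => inner ℂ (g x) (f x)) x ∂μ := (integral_indicator hA).symm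
      _ = ∫ x, inner ℂ (g x) (hf.toLp _ x) ∂μ := by
          refine integral_congr_ae ?_
          filter_upwards [hf.coeFn_toLp] with x hx
          rw [hx]
          by_cases hxA : x ∈ A <;> simp [hxA]
  rw [this]
  exact hf.coeFn_toLp

theorem restrict_comp_extendByZero {A : Set α} (hA : MeasurableSet A) :
    LpToLpRestrictCLM α ℂ ℂ μ 2 A ∘L extendByZero μ A = 1 := by
  ext f
  filter_upwards [LpToLpRestrictCLM_coeFn ℂ A (extendByZero μ A f),
    ae_restrict_of_ae (coeFn_extendByZero hA f), ae_restrict_mem hA] with x h1 h2 hx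
  rw [ContinuousLinearMap.comp_apply, h1, h2, Set.indicator_of_mem hx, one_apply_eq_self]

theorem extendByZero_comp_restrict {A : Set α} (hA : MeasurableSet A) :
    extendByZero μ A ∘L LpToLpRestrictCLM α ℂ ℂ μ 2 A =
      mulOperator (memLp_top_indicator_one hA) := by
  ext f
  filter_upwards [coeFn_extendByZero hA (LpToLpRestrictCLM α ℂ ℂ μ 2 A f),
    (ae_restrict_iff' hA).1 (LpToLpRestrictCLM_coeFn ℂ A f),
    coeFn_mulOperator (memLp_top_indicator_one hA) f] with x h1 h2 h3
  rw [ContinuousLinearMap.comp_apply, h1, h3]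
  by_cases hx : x ∈ A
  · simp [hx, h2 hx]
  · simp [hx]

end Restriction

section Module

variable {E : Type*} [NormedAddCommGroup E] [InnerProductSpace ℝ E]
  [FiniteDimensional ℝ E] [MeasurableSpace E] [BorelSpace E]

theorem norm_translation_le (x : E) : ‖translation x‖ ≤ 1 :=
  LinearIsometry.norm_toContinuousLinearMap_le _

theorem adjoint_translation (x : E) :
    ContinuousLinearMap.adjoint (translation x) = translation (-x) := by
  symm
  rw [ContinuousLinearMap.eq_adjoint_iff]
  intro f g
  rw [L2.inner_def, L2.inner_def, ← integral_sub_right_eq_self _ x]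
  refine integral_congr_ae ?_
  filter_upwards [ae_comp_sub (coeFn_translation (-x) f) x, coeFn_translation x g] with y h1 h2
  rw [h1, h2, sub_neg_eq_add, sub_add_cancel]

theorem translation_comp_extendByZero {A : Set E} (hA : MeasurableSet A) {x : E}
    (hx : ∀ y ∈ A, y + x ∈ A)
    {X : Lp ℂ 2 (volume.restrict A) →L[ℂ] Lp ℂ 2 (volume.restrict A)}
    (hX : ∀ f, X f =ᵐ[volume.restrict A] fun y => A.indicator f (y - x)) :
    translation x ∘L extendByZero volume A = extendByZero volume A ∘L X := by
  ext f
  filter_upwards [coeFn_translation x (extendByZero volume A f),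
    ae_comp_sub (coeFn_extendByZero hA f) x, coeFn_extendByZero hA (X f),
    (ae_restrict_iff' hA).1 (hX f)] with y h1 h2 h3 h4
  rw [ContinuousLinearMap.comp_apply, ContinuousLinearMap.comp_apply, h1, h2, h3]
  by_cases hy : y ∈ A
  · rw [Set.indicator_of_mem hy, h4 hy]
  · have : y - x ∉ A := fun h => hy (by simpa using hx _ h)
    simp [hy, this]

theorem tendsto_translation_compression {A : Set E} (hA : MeasurableSet A) {p : E}
    (hp : ∀ y ∈ A, y + p ∈ A) (hexh : ∀ y, ∃ n : ℕ, y + n • p ∈ A)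
    (f : Lp ℂ 2 (volume : Measure E)) :
    Tendsto (fun n : ℕ => translation (-(n • p)) (extendByZero volume A
      (LpToLpRestrictCLM E ℂ ℂ volume 2 A (translation (n • p) f)))) atTop (𝓝 f) := by
  let S : ℕ → Set E := fun n => {y | y + n • p ∉ A}
  have hS : ∀ n, MeasurableSet (S n) := fun n =>
    hA.compl.preimage (measurable_id.add_const (n • p))
  have hanti : Antitone S := antitone_nat_of_succ_le fun n y hy h => hy (by
    rw [succ_nsmul, ← add_assoc]
    exact hp _ h)
  have hempty : ⋂ n, S n = ∅ := by
    refine Set.eq_empty_of_forall_notMem fun y hy => ?_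
    obtain ⟨n, hn⟩ := hexh y
    exact Set.mem_iInter.1 hy n hn
  have h_int : Integrable (fun x => ‖f x‖ ^ 2) (volume : Measure E) :=
    (memLp_two_iff_integrable_sq_norm (Lp.memLp f).1).1 (Lp.memLp f)
  have hlim := tendsto_setIntegral_of_antitone hS hanti ⟨0, h_int.integrableOn⟩
  rw [hempty, setIntegral_empty] at hlim
  have hdiff : ∀ n : ℕ, translation (-(n • p)) (extendByZero volume A
      (LpToLpRestrictCLM E ℂ ℂ volume 2 A (translation (n • p) f))) - f =
      -mulOperator (memLp_top_indicator_one (hS n)) f := by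
    intro n
    have h1 := DFunLike.congr_fun (extendByZero_comp_restrict (μ := volume) hA)
      (translation (n • p) f)
    rw [ContinuousLinearMap.comp_apply] at h1
    rw [h1]
    ext
    filter_upwards [Lp.coeFn_sub (translation (-(n • p)) (mulOperator
        (memLp_top_indicator_one hA) (translation (n • p) f))) f,
      coeFn_translation (-(n • p)) (mulOperator (memLp_top_indicator_one hA)
        (translation (n • p) f)),
      ae_comp_sub (coeFn_mulOperator (memLp_top_indicator_one hA) (translation (n • p) f))
        (-(n • p)),
      ae_comp_sub (coeFn_translation (n • p) f) (-(n • p)),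
      Lp.coeFn_neg (mulOperator (memLp_top_indicator_one (hS n)) f),
      coeFn_mulOperator (memLp_top_indicator_one (hS n)) f] with y h1 h2 h3 h4 h5 h6
    rw [h1, h5, Pi.sub_apply, Pi.neg_apply, h2, h3, h4, h6]
    simp only [sub_neg_eq_add, add_sub_cancel_right]
    by_cases hy : y + n • p ∈ A
    · simp [S, hy]
    · simp [S, hy]
  rw [tendsto_iff_norm_sub_tendsto_zero]
  simp only [hdiff, norm_neg]
  have h := hlim.sqrt
  simp only [← norm_sq_mulOperator_indicator (hS _) (memLp_top_indicator_one (hS _)),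
    Real.sqrt_sq (norm_nonneg _), Real.sqrt_zero] at h
  exact h

end Module

section Cone

variable {E : Type*} [NormedAddCommGroup E] [NormedSpace ℝ E] {P A : Set E}

theorem add_mem_of_convex_of_smul_mem (hconvex : Convex ℝ P)
    (hcone : ∀ x ∈ P, ∀ t : ℝ, 0 ≤ t → t • x ∈ P) {x y : E} (hx : x ∈ P) (hy : y ∈ P) :
    x + y ∈ P := by
  have h := hcone _ (hconvex hx hy (a := 1 / 2) (b := 1 / 2) (by norm_num) (by norm_num)
    (by norm_num)) 2 (by norm_num)
  simpa [smul_smul] using h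

theorem interior_nonempty_of_span [FiniteDimensional ℝ E] (hconvex : Convex ℝ P) (h0 : (0 : E) ∈ P)
    (hspan : ∀ v : E, ∃ x ∈ P, ∃ y ∈ P, v = x - y) : (interior P).Nonempty := by
  rw [hconvex.interior_nonempty_iff_affineSpan_eq_top, eq_top_iff]
  rintro v -
  obtain ⟨x, hx, y, hy, rfl⟩ := hspan v
  simpa using (affineSpan ℝ P).smul_vsub_vadd_mem 1 (subset_affineSpan ℝ P hx)
    (subset_affineSpan ℝ P hy) (subset_affineSpan ℝ P h0)

theorem subset_closure_interior_of_add_mem (hconvex : Convex ℝ P) (h0 : (0 : E) ∈ P)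
    (hP : (interior P).Nonempty) (hmod : ∀ b ∈ A, ∀ p ∈ P, b + p ∈ A) :
    A ⊆ closure (interior A) := by
  intro a ha
  have hmaps : Set.MapsTo (fun y => a + y) (interior P) (interior A) := by
    intro y hy
    refine interior_maximal ?_ ((Homeomorph.addLeft a).isOpenMap _ isOpen_interior) ⟨y, hy, rfl⟩
    rintro _ ⟨z, hz, rfl⟩
    exact hmod a ha z (interior_subset hz)
  have h0' : (0 : E) ∈ closure (interior P) := by
    rw [hconvex.closure_interior_eq_closure_of_nonempty_interior hP]
    exact subset_closure h0
  simpa using map_mem_closure (continuous_const.add continuous_id) h0' hmaps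

theorem exists_add_nsmul_mem_of_mem_interior (hcone : ∀ x ∈ P, ∀ t : ℝ, 0 ≤ t → t • x ∈ P)
    {p : E} (hp : p ∈ interior P) (y : E) : ∃ n : ℕ, y + n • p ∈ P := by
  have hlim : Tendsto (fun n : ℕ => (1 / ((n : ℝ) + 1)) • y + p) atTop (𝓝 p) := by
    simpa using (tendsto_one_div_add_atTop_nhds_zero_nat (𝕜 := ℝ)).smul_const y |>.add_const p
  obtain ⟨n, hn⟩ := (hlim.eventually_mem (mem_interior_iff_mem_nhds.1 hp)).exists
  refine ⟨n + 1, ?_⟩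
  have hn0 : (n : ℝ) + 1 ≠ 0 := by positivity
  have h := hcone _ hn ((n : ℝ) + 1) (by positivity)
  rw [smul_add, smul_smul, mul_one_div_cancel hn0, one_smul] at h
  rwa [← Nat.cast_smul_eq_nsmul ℝ, Nat.cast_add, Nat.cast_one]

end Cone

section Commutant

variable {E : Type*} [NormedAddCommGroup E] [InnerProductSpace ℝ E]
  [FiniteDimensional ℝ E] [MeasurableSpace E] [BorelSpace E]

theorem commute_translation_sub
    {T : Lp ℂ 2 (volume : Measure E) →L[ℂ] Lp ℂ 2 (volume : Measure E)} {x y : E}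
    (hx : Commute T (translation x)) (hy : Commute T (translation y)) :
    Commute T (translation (x - y)) := by
  have hinv : translation y * translation (-y) = 1 := by
    rw [← translation_add, add_neg_cancel, translation_zero]
  have hinv' : translation (-y) * translation y = 1 := by
    rw [← translation_add, neg_add_cancel, translation_zero]
  have hy' : Commute T (translation (-y)) :=
    Commute.units_inv_right (u := ⟨translation y, translation (-y), hinv, hinv'⟩) hy
  rw [sub_eq_add_neg, translation_add]
  exact hx.mul_right hy'

theorem commute_indicator_translate {A : Set E} (hA : MeasurableSet A)
    {T : Lp ℂ 2 (volume : Measure E) →L[ℂ] Lp ℂ 2 (volume : Measure E)}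
    (hTW : ∀ x, Commute T (translation x))
    (hTA : Commute T (mulOperator (memLp_top_indicator_one hA))) (x : E)
    (hu : MemLp (fun y => A.indicator (fun _ => (1 : ℂ)) (y - x)) ∞ volume) :
    Commute T (mulOperator hu) := by
  have h : mulOperator hu =
      translation x * mulOperator (memLp_top_indicator_one hA) * translation (-x) := by
    rw [translation_mulOperator x _ hu, mul_assoc, ← translation_add, add_neg_cancel,
      translation_zero, mul_one]
  rw [h]
  exact ((hTW x).mul_right hTA).mul_right (hTW (-x))

variable {P A : Set E} {V U : E → Lp ℂ 2 (volume.restrict A) →L[ℂ] Lp ℂ 2 (volume.restrict A)}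

theorem isotropy_comp_extendByZero (hA : MeasurableSet A)
    (hU : ∀ z ∈ isotropy A, ∀ f, U z f =ᵐ[volume.restrict A] fun y => f (y - z))
    {z : E} (hz : z ∈ isotropy A) :
    translation z ∘L extendByZero volume A = extendByZero volume A ∘L U z := by
  refine translation_comp_extendByZero hA (fun y hy => (hz y).2 hy) fun f => ?_
  filter_upwards [hU z hz f, ae_restrict_mem hA] with y h hy
  rw [h, Set.indicator_of_mem]
  rwa [← hz, sub_add_cancel]

theorem adjoint_comp_restrict {x : E}
    {X : Lp ℂ 2 (volume.restrict A) →L[ℂ] Lp ℂ 2 (volume.restrict A)}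
    (h : translation x ∘L extendByZero volume A = extendByZero volume A ∘L X) :
    ContinuousLinearMap.adjoint X ∘L LpToLpRestrictCLM E ℂ ℂ volume 2 A =
      LpToLpRestrictCLM E ℂ ℂ volume 2 A ∘L translation (-x) := by
  have h' := congrArg ContinuousLinearMap.adjoint h
  rw [ContinuousLinearMap.adjoint_comp, ContinuousLinearMap.adjoint_comp, adjoint_translation,
    extendByZero, ContinuousLinearMap.adjoint_adjoint] at h'
  exact h'.symm

theorem restrict_comp_translation (hA : MeasurableSet A)
    (hU : ∀ z ∈ isotropy A, ∀ f, U z f =ᵐ[volume.restrict A] fun y => f (y - z))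
    {z : E} (hz : z ∈ isotropy A) :
    LpToLpRestrictCLM E ℂ ℂ volume 2 A ∘L translation z =
      U z ∘L LpToLpRestrictCLM E ℂ ℂ volume 2 A := by
  have h := adjoint_comp_restrict (isotropy_comp_extendByZero hA hU (neg_mem hz))
  rw [neg_neg] at h
  have hadj : ContinuousLinearMap.adjoint (U (-z)) = U z :=
    calc ContinuousLinearMap.adjoint (U (-z))
        = (ContinuousLinearMap.adjoint (U (-z)) ∘L LpToLpRestrictCLM E ℂ ℂ volume 2 A) ∘L
            extendByZero volume A := by
          rw [ContinuousLinearMap.comp_assoc, restrict_comp_extendByZero hA]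
          rfl
      _ = (LpToLpRestrictCLM E ℂ ℂ volume 2 A ∘L extendByZero volume A) ∘L U z := by
          rw [h, ContinuousLinearMap.comp_assoc, isotropy_comp_extendByZero hA hU hz,
            ContinuousLinearMap.comp_assoc]
      _ = U z := by
          rw [restrict_comp_extendByZero hA]
          rfl
  rw [← h, hadj]

theorem commute_of_translation_comp_extendByZero (hA : MeasurableSet A) {x y : E}
    {X Y : Lp ℂ 2 (volume.restrict A) →L[ℂ] Lp ℂ 2 (volume.restrict A)}
    (hX : translation x ∘L extendByZero volume A = extendByZero volume A ∘L X)
    (hY : translation y ∘L extendByZero volume A = extendByZero volume A ∘L Y) :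
    Commute X Y := by
  have hinj : Function.Injective (extendByZero volume A) :=
    Function.LeftInverse.injective (g := LpToLpRestrictCLM E ℂ ℂ volume 2 A)
      (DFunLike.congr_fun (restrict_comp_extendByZero hA))
  have hX' : ∀ f, translation x (extendByZero volume A f) = extendByZero volume A (X f) :=
    DFunLike.congr_fun hX
  have hY' : ∀ f, translation y (extendByZero volume A f) = extendByZero volume A (Y f) :=
    DFunLike.congr_fun hY
  refine ContinuousLinearMap.ext fun f => hinj ?_
  rw [mul_apply_eq_comp, mul_apply_eq_comp, ← hX', ← hY', ← hY', ← hX', ← mul_apply_eq_comp,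
    ← mul_apply_eq_comp, ← translation_add, ← translation_add, add_comm]

theorem commute_of_comp_restrict (hA : MeasurableSet A) {x y : E}
    {X Y : Lp ℂ 2 (volume.restrict A) →L[ℂ] Lp ℂ 2 (volume.restrict A)}
    (hX : X ∘L LpToLpRestrictCLM E ℂ ℂ volume 2 A =
      LpToLpRestrictCLM E ℂ ℂ volume 2 A ∘L translation x)
    (hY : Y ∘L LpToLpRestrictCLM E ℂ ℂ volume 2 A =
      LpToLpRestrictCLM E ℂ ℂ volume 2 A ∘L translation y) :
    Commute X Y := by
  have hsurj : Function.Surjective (LpToLpRestrictCLM E ℂ ℂ volume 2 A) :=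
    Function.RightInverse.surjective (g := extendByZero volume A)
      (DFunLike.congr_fun (restrict_comp_extendByZero hA))
  have hX' : ∀ f, X (LpToLpRestrictCLM E ℂ ℂ volume 2 A f) =
      LpToLpRestrictCLM E ℂ ℂ volume 2 A (translation x f) := DFunLike.congr_fun hX
  have hY' : ∀ f, Y (LpToLpRestrictCLM E ℂ ℂ volume 2 A f) =
      LpToLpRestrictCLM E ℂ ℂ volume 2 A (translation y f) := DFunLike.congr_fun hY
  refine ContinuousLinearMap.ext fun g => ?_
  obtain ⟨f, rfl⟩ := hsurj g
  rw [mul_apply_eq_comp, mul_apply_eq_comp, hX', hY', hY', hX', ← mul_apply_eq_comp,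
    ← mul_apply_eq_comp, ← translation_add, ← translation_add, add_comm]

/-- An operator on `L²(A)` commuting with the isometries `V x` and their adjoints commutes with
every operator commuting with the translations by the isotropy group. -/
theorem commute_of_commute_isometries (hPconvex : Convex ℝ P)
    (hPcone : ∀ x ∈ P, ∀ t : ℝ, 0 ≤ t → t • x ∈ P)
    (hPspan : ∀ v : E, ∃ x ∈ P, ∃ y ∈ P, v = x - y)
    (hA : IsClosed A) (hAzero : (0 : E) ∈ A) (hAmod : ∀ b ∈ A, ∀ p ∈ P, b + p ∈ A)
    (hV : ∀ x ∈ P, translation x ∘L extendByZero volume A = extendByZero volume A ∘L V x)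
    (hU : ∀ z ∈ isotropy A, ∀ f, U z f =ᵐ[volume.restrict A] fun y => f (y - z))
    {T S : Lp ℂ 2 (volume.restrict A) →L[ℂ] Lp ℂ 2 (volume.restrict A)}
    (hTV : ∀ x ∈ P, Commute T (V x))
    (hTV' : ∀ x ∈ P, Commute T (ContinuousLinearMap.adjoint (V x)))
    (hS : ∀ z ∈ isotropy A, Commute S (U z)) : Commute T S := by
  have hAm := hA.measurableSet
  have h0 : (0 : E) ∈ P := by
    obtain ⟨x, hx, -⟩ := hPspan 0
    simpa using hPcone x hx 0 le_rfl
  have hPint := interior_nonempty_of_span hPconvex h0 hPspan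
  obtain ⟨p, hp⟩ := hPint
  let Q : AddSubmonoid E :=
    { carrier := P
      zero_mem' := h0
      add_mem' := add_mem_of_convex_of_smul_mem hPconvex hPcone }
  have hexh : ∀ y, ∃ n : ℕ, y + n • p ∈ A := by
    intro y
    obtain ⟨n, hn⟩ := exists_add_nsmul_mem_of_mem_interior hPcone hp y
    exact ⟨n, by simpa using hAmod 0 hAzero _ hn⟩
  obtain ⟨T', hT'ι, hρT', hT'W⟩ := exists_lift_of_commute_compression (P := Q)
    (V := V) (X := fun x => ContinuousLinearMap.adjoint (V x)) (p := p)
    (restrict_comp_extendByZero hAm) translation_zero translation_add norm_translation_le hV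
    (fun x hx => adjoint_comp_restrict (hV x hx)) (interior_subset hp)
    (tendsto_translation_compression hAm (fun y hy => hAmod y hy p (interior_subset hp)) hexh)
    hTV hTV'
  have hT'W' : ∀ x, Commute T' (translation x) := by
    intro v
    obtain ⟨x, hx, y, hy, rfl⟩ := hPspan v
    exact commute_translation_sub (hT'W x hx) (hT'W y hy)
  have hT'A : Commute T' (mulOperator (memLp_top_indicator_one hAm)) := by
    rw [← extendByZero_comp_restrict hAm]
    change T' ∘L (extendByZero volume A ∘L LpToLpRestrictCLM E ℂ ℂ volume 2 A) =
      (extendByZero volume A ∘L LpToLpRestrictCLM E ℂ ℂ volume 2 A) ∘L T'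
    rw [← ContinuousLinearMap.comp_assoc, hT'ι, ContinuousLinearMap.comp_assoc, ← hρT',
      ContinuousLinearMap.comp_assoc]
  have hcomm : Commute T'
      (extendByZero volume A ∘L S ∘L LpToLpRestrictCLM E ℂ ℂ volume 2 A) := by
    refine commute_of_commute_translation (isotropy A : Set E) (fun z hz => neg_mem hz) hT'W'
      (fun ξ hξ => commute_unitaryCharacter_of_commute_indicator hA
        (subset_closure_interior_of_add_mem hPconvex h0 ⟨p, hp⟩ hAmod) T'
        (commute_indicator_translate hAm hT'W' hT'A) hξ) fun z hz => ?_
    have h1 : ∀ f, translation z (extendByZero volume A f) = extendByZero volume A (U z f) :=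
      DFunLike.congr_fun (isotropy_comp_extendByZero hAm hU hz)
    have h2 : ∀ f, LpToLpRestrictCLM E ℂ ℂ volume 2 A (translation z f) =
        U z (LpToLpRestrictCLM E ℂ ℂ volume 2 A f) :=
      DFunLike.congr_fun (restrict_comp_translation hAm hU hz)
    have h3 : ∀ f, S (U z f) = U z (S f) := DFunLike.congr_fun (hS z hz).eq
    refine ContinuousLinearMap.ext fun f => ?_
    simp only [mul_apply_eq_comp, ContinuousLinearMap.comp_apply, h1, h2, h3]
  have hρι : ∀ f, LpToLpRestrictCLM E ℂ ℂ volume 2 A (extendByZero volume A f) = f :=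
    DFunLike.congr_fun (restrict_comp_extendByZero hAm)
  have hT'ι' : ∀ f, T' (extendByZero volume A f) = extendByZero volume A (T f) :=
    DFunLike.congr_fun hT'ι
  refine ContinuousLinearMap.ext fun f => ?_
  have h := congrArg (LpToLpRestrictCLM E ℂ ℂ volume 2 A)
    (DFunLike.congr_fun hcomm.eq (extendByZero volume A f))
  simpa only [mul_apply_eq_comp, ContinuousLinearMap.comp_apply, hT'ι', hρι] using h

end Commutant

/-- For `d ≥ 2` and a `P`-module `A`, let `V` be the isometric representation of `P`
on `L²(A)` of multiplicity one and, for `z` in the isotropy group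
`G_A = {z : A + z = A}`, let `U_z` be the translation unitary `(U_z f)(x) = f (x - z)`.
Then the commutant of the von Neumann algebra generated by `{V_x : x ∈ P}` is the von
Neumann algebra generated by `{U_z : z ∈ G_A}`. -/
theorem commutant_eq_isotropy_vonNeumann
    (d : ℕ) (hd : 2 ≤ d) (P A : Set (EuclideanSpace ℝ (Fin d)))
    (hPclosed : IsClosed P) (hPconvex : Convex ℝ P)
    (hPcone : ∀ x ∈ P, ∀ t : ℝ, 0 ≤ t → t • x ∈ P)
    (hPspan : ∀ v : EuclideanSpace ℝ (Fin d), ∃ x ∈ P, ∃ y ∈ P, v = x - y)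
    (hPpointed : P ∩ (-P) = {0})
    (hAclosed : IsClosed A) (hAproper : A ≠ Set.univ)
    (hAzero : (0 : EuclideanSpace ℝ (Fin d)) ∈ A)
    (hAmod : ∀ b ∈ A, ∀ p ∈ P, b + p ∈ A)
    (V : EuclideanSpace ℝ (Fin d) →
      (Lp ℂ 2 (volume.restrict A) →L[ℂ] Lp ℂ 2 (volume.restrict A)))
    (hV : ∀ x ∈ P, ∀ f : Lp ℂ 2 (volume.restrict A),
      ⇑(V x f) =ᵐ[volume.restrict A] fun y => A.indicator (⇑f) (y - x))
    (U : EuclideanSpace ℝ (Fin d) →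
      (Lp ℂ 2 (volume.restrict A) →L[ℂ] Lp ℂ 2 (volume.restrict A)))
    (hU : ∀ z : EuclideanSpace ℝ (Fin d), (fun b => b + z) '' A = A →
      ∀ f : Lp ℂ 2 (volume.restrict A),
        ⇑(U z f) =ᵐ[volume.restrict A] fun y => f (y - z)) :
    Set.centralizer
        ({T | ∃ x ∈ P, T = V x} ∪ {T | ∃ x ∈ P, T = ContinuousLinearMap.adjoint (V x)}) =
      Set.centralizer (Set.centralizer
        {T | ∃ z : EuclideanSpace ℝ (Fin d), (fun b => b + z) '' A = A ∧ T = U z}) := by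
  have hAm := hAclosed.measurableSet
  have hV' : ∀ x ∈ P, translation x ∘L extendByZero volume A = extendByZero volume A ∘L V x :=
    fun x hx => translation_comp_extendByZero hAm (fun y hy => hAmod y hy x hx) (hV x hx)
  have hU' : ∀ z ∈ isotropy A, ∀ f, U z f =ᵐ[volume.restrict A] fun y => f (y - z) :=
    fun z hz => hU z (mem_isotropy_iff_image_eq.1 hz)
  refine Set.Subset.antisymm (fun T hT => ?_) (fun T hT => ?_)
  · rw [Set.mem_centralizer_iff] at hT ⊢
    intro S hS
    rw [Set.mem_centralizer_iff] at hS
    have hcomm : Commute T S := commute_of_commute_isometries hPconvex hPcone hPspan hAclosed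
      hAzero hAmod hV' hU' (fun x hx => (hT _ (Or.inl ⟨x, hx, rfl⟩)).symm)
      (fun x hx => (hT _ (Or.inr ⟨x, hx, rfl⟩)).symm)
      (fun z hz => (hS _ ⟨z, mem_isotropy_iff_image_eq.1 hz, rfl⟩).symm)
    exact hcomm.symm
  · rw [Set.mem_centralizer_iff] at hT ⊢
    rintro _ (⟨x, hx, rfl⟩ | ⟨x, hx, rfl⟩)
    · refine hT _ (Set.mem_centralizer_iff.2 ?_)
      rintro _ ⟨z, hz, rfl⟩
      exact commute_of_translation_comp_extendByZero hAm
        (isotropy_comp_extendByZero hAm hU' (mem_isotropy_iff_image_eq.2 hz)) (hV' x hx)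
    · refine hT _ (Set.mem_centralizer_iff.2 ?_)
      rintro _ ⟨z, hz, rfl⟩
      exact commute_of_comp_restrict hAm
        (restrict_comp_translation hAm hU' (mem_isotropy_iff_image_eq.2 hz)).symm
        (adjoint_comp_restrict (hV' x hx))
end
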